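/- arXiv:2110.11789 — 7 statements merged into one kernel-verified Lean document; each statement's English description precedes it below -/
import Mathlib

section
/- Fix an integer d ≥ 1 and real numbers λ ≠ 0, N > 0. Let ε_1,…,ε_d be pairwise distinct complex numbers and ϱ_1,…,ϱ_d nonzero reals, and define the rational function R(z) := z − (λ/N)·Σ_{k=1}^d ϱ_k/(ε_k + z). Set e_k := R(ε_k) and r_k := ϱ_k·R'(ε_k), and assume e_1,…,e_d are pairwise distinct. For each k let ε̂_k^1,…,ε̂_k^d be complex numbers such that the polynomial identity (in the variable v) (R(v) − R(ε_k))·∏_{i=1}^d (ε_i + v) = (v − ε_k)·∏_{j=1}^d (v − ε̂_k^j) holds. Define 𝒢(z,w) := [1 − (λ/N)·Σ_{k=1}^d r_k/((R(z) − R(ε_k))·(R(ε_k) − R(−w))) · ∏_{j=1}^d (R(w) − R(−ε̂_k^j))/(R(w) − R(ε_j))] / (R(w) − R(−z)). Then 𝒢 is symmetric: 𝒢(z,w) = 𝒢(w,z) for all complex z, w at which every denominator occurring in both expressions is nonzero. -/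
open Finset

/-- The polynomial `(R(v) - u) ∏ᵢ (εᵢ + v)` in `v`, for `R(v) = v - c ∑ₖ ρₖ/(εₖ + v)`. -/
def levelPoly {d : ℕ} (c : ℂ) (ε ρ : Fin d → ℂ) (u v : ℂ) : ℂ :=
  (v - u) * ∏ i, (ε i + v) - c * ∑ k, ρ k * ∏ i ∈ univ.erase k, (ε i + v)

/-- A monic complex polynomial of degree `n` is a product of `n` linear factors. -/
lemma exists_eval_eq_prod_of_monic {n : ℕ} (P : Polynomial ℂ) (hP : P.Monic)
    (hn : P.natDegree = n) :
    ∃ f : Fin n → ℂ, ∀ v, P.eval v = ∏ i, (v - f i) := by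
  have hs := IsAlgClosed.splits P
  have hcard : P.roots.toList.length = n := by
    rw [Multiset.length_toList, ← hs.natDegree_eq_card_roots, hn]
  subst hcard
  refine ⟨P.roots.toList.get, fun v => ?_⟩
  conv_lhs => rw [hs.eq_prod_roots_of_monic hP]
  rw [Polynomial.eval_multiset_prod, Multiset.map_map, ← List.prod_ofFn,
    ← Multiset.prod_coe, ← Function.comp_def (fun x => v - x), ← List.map_ofFn, List.ofFn_get,
    ← Multiset.map_coe, Multiset.coe_toList]
  simp

section levelPoly

variable {d : ℕ} {c : ℂ} {ε ρ : Fin d → ℂ} {R : ℂ → ℂ}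

lemma continuous_levelPoly (u : ℂ) : Continuous (levelPoly c ε ρ u) := by
  unfold levelPoly
  fun_prop

/-- `levelPoly` splits into linear factors, with any prescribed zero coming first. -/
lemma exists_levelPoly_eq_prod (u w : ℂ) (hw : levelPoly c ε ρ u w = 0) :
    ∃ f : Fin (d + 1) → ℂ, f 0 = w ∧ ∀ v, levelPoly c ε ρ u v = ∏ i, (v - f i) := by
  open Polynomial in
  let A : ℂ[X] := ∏ i, (X + C (ε i))
  let B : ℂ[X] := C c * ∑ k, C (ρ k) * ∏ i ∈ univ.erase k, (X + C (ε i))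
  have hA : A.Monic := Polynomial.monic_prod_of_monic _ _ fun i _ => Polynomial.monic_X_add_C _
  have hAdeg : A.natDegree = d := by
    simp only [A]
    rw [Polynomial.natDegree_prod_of_monic _ _ fun i _ => Polynomial.monic_X_add_C _]
    simp
  have hMon : ((Polynomial.X - Polynomial.C u) * A).Monic := (Polynomial.monic_X_sub_C u).mul hA
  have hdeg : ((Polynomial.X - Polynomial.C u) * A).natDegree = d + 1 := by
    rw [(Polynomial.monic_X_sub_C u).natDegree_mul hA, hAdeg, Polynomial.natDegree_X_sub_C,
      add_comm]
  have hB : B.natDegree ≤ d := by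
    refine (Polynomial.natDegree_C_mul_le _ _).trans ?_
    refine Polynomial.natDegree_sum_le_of_forall_le _ _ fun k _ => ?_
    refine (Polynomial.natDegree_C_mul_le _ _).trans ?_
    rw [Polynomial.natDegree_prod_of_monic _ _ fun i _ => Polynomial.monic_X_add_C _]
    simp
  have hlt : B.degree < ((Polynomial.X - Polynomial.C u) * A).degree := by
    rw [Polynomial.degree_eq_natDegree hMon.ne_zero, hdeg]
    refine Polynomial.degree_le_natDegree.trans_lt ?_
    exact_mod_cast Nat.lt_succ_of_le hB
  have hP : ((Polynomial.X - Polynomial.C u) * A - B).Monic := hMon.sub_of_left hlt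
  have hPdeg : ((Polynomial.X - Polynomial.C u) * A - B).natDegree = d + 1 := by
    rw [Polynomial.natDegree_sub_eq_left_of_natDegree_lt (by omega), hdeg]
  have heval : ∀ v, ((Polynomial.X - Polynomial.C u) * A - B).eval v = levelPoly c ε ρ u v := by
    intro v
    simp [A, B, levelPoly, Polynomial.eval_prod, Polynomial.eval_finsetSum, add_comm]
  obtain ⟨g, hg⟩ := exists_eval_eq_prod_of_monic _ hP hPdeg
  have hw0 : ∏ i, (w - g i) = 0 := by rw [← hg, heval, hw]
  obtain ⟨i, -, hi⟩ := prod_eq_zero_iff.mp hw0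
  refine ⟨g ∘ Equiv.swap 0 i, ?_, fun v => ?_⟩
  · simpa using (sub_eq_zero.mp hi).symm
  · rw [← heval, hg]
    exact (Equiv.prod_comp (Equiv.swap 0 i) fun j => v - g j).symm

lemma sub_mul_prod_eq_levelPoly (hR : ∀ z, R z = z - c * ∑ k, ρ k / (ε k + z)) (u v : ℂ)
    (hv : ∀ i, ε i + v ≠ 0) : (R v - u) * ∏ i, (ε i + v) = levelPoly c ε ρ u v := by
  have h : (∑ k, ρ k / (ε k + v)) * ∏ i, (ε i + v)
      = ∑ k, ρ k * ∏ i ∈ univ.erase k, (ε i + v) := by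
    rw [sum_mul]
    refine sum_congr rfl fun k _ => ?_
    rw [← mul_prod_erase univ _ (mem_univ k)]
    field_simp [hv k]
  rw [hR, levelPoly, ← h]
  ring

lemma levelPoly_neg (u : ℂ) (k : Fin d) :
    levelPoly c ε ρ u (-ε k) = -(c * ρ k * ∏ i ∈ univ.erase k, (ε i - ε k)) := by
  have h0 : ∏ i, (ε i + -ε k) = 0 := prod_eq_zero (mem_univ k) (by ring)
  rw [levelPoly, h0, sum_eq_single k]
  · simp only [← sub_eq_add_neg]
    ring
  · intro j _ hj
    rw [prod_eq_zero (i := k) (by simp [hj.symm]) (by ring), mul_zero]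
  · simp

/-- A factorization valid away from the poles of `R` holds everywhere. -/
lemma levelPoly_eq_of_forall_ne (hR : ∀ z, R z = z - c * ∑ k, ρ k / (ε k + z)) (u a : ℂ)
    (b : Fin d → ℂ)
    (h : ∀ v, (∀ i, ε i + v ≠ 0) → (R v - u) * ∏ i, (ε i + v) = (v - a) * ∏ j, (v - b j))
    (v : ℂ) : levelPoly c ε ρ u v = (v - a) * ∏ j, (v - b j) := by
  have hdense : Dense (Set.range fun i => -ε i)ᶜ :=
    (Set.finite_range _).countable.dense_compl ℝ
  refine congrFun (Continuous.ext_on hdense (continuous_levelPoly u)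
    (by fun_prop : Continuous fun v => (v - a) * ∏ j, (v - b j)) fun x hx => ?_) v
  have hx' : ∀ i, ε i + x ≠ 0 := fun i hi => hx ⟨i, neg_eq_of_add_eq_zero_right hi⟩
  rw [← sub_mul_prod_eq_levelPoly hR u x hx', h x hx']

lemma add_ne_zero_of_levelPoly_eq_zero (hc : c ≠ 0) (hρ : ∀ k, ρ k ≠ 0)
    (hε : Function.Injective ε) {u v : ℂ} (h : levelPoly c ε ρ u v = 0) (i : Fin d) :
    ε i + v ≠ 0 := by
  intro hi
  rw [show v = -ε i from (neg_eq_of_add_eq_zero_right hi).symm, levelPoly_neg, neg_eq_zero] at h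
  refine mul_ne_zero (mul_ne_zero hc (hρ i)) (prod_ne_zero_iff.mpr fun j hj => ?_) h
  exact sub_ne_zero.mpr fun hji => (mem_erase.mp hj).1 (hε hji)

lemma deriv_mul_prod_eq (hR : ∀ z, R z = z - c * ∑ k, ρ k / (ε k + z)) (a : ℂ)
    (ha : ∀ i, ε i + a ≠ 0) (b : Fin d → ℂ)
    (h : ∀ v, levelPoly c ε ρ (R a) v = (v - a) * ∏ j, (v - b j)) :
    deriv R a * ∏ i, (ε i + a) = ∏ j, (a - b j) := by
  have hA : ∏ i, (ε i + a) ≠ 0 := prod_ne_zero_iff.mpr fun i _ => ha i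
  have hcont : Continuous fun v => ∏ i, (ε i + v) := by fun_prop
  have hev : R =ᶠ[nhds a]
      fun v => R a + (v - a) * ((∏ j, (v - b j)) / ∏ i, (ε i + v)) := by
    filter_upwards [hcont.continuousAt.eventually_ne hA] with v hv
    have hv' : ∀ i, ε i + v ≠ 0 := fun i => prod_ne_zero_iff.mp hv i (mem_univ i)
    have := sub_mul_prod_eq_levelPoly hR (R a) v hv'
    rw [h v] at this
    field_simp
    linear_combination this
  have hg : DifferentiableAt ℂ (fun v => (∏ j, (v - b j)) / ∏ i, (ε i + v)) a := by
    refine DifferentiableAt.div ?_ ?_ hA <;> fun_prop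
  have hd := (((hasDerivAt_id a).sub_const a).mul hg.hasDerivAt).const_add (R a)
  have hd' : deriv R a = (∏ j, (a - b j)) / ∏ i, (ε i + a) := by
    rw [hev.deriv_eq]
    refine (hd.congr_deriv ?_).deriv
    simp
  rw [hd', div_mul_cancel₀ _ hA]

/-- `∏ᵢ (x - R(-fᵢ))` in terms of the values of `levelPoly`. -/
lemma prod_sub_mul_prod_eq (hR : ∀ z, R z = z - c * ∑ k, ρ k / (ε k + z)) {n : ℕ}
    (f : Fin n → ℂ) (hf : ∀ i j, ε i - f j ≠ 0) (x : ℂ) :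
    (∏ j, (x - R (-f j))) * ∏ j, ∏ i, (ε i - f j) = ∏ j, -levelPoly c ε ρ x (-f j) := by
  rw [← prod_mul_distrib]
  refine prod_congr rfl fun j _ => ?_
  rw [← sub_mul_prod_eq_levelPoly hR x (-f j) fun i => by simpa [sub_eq_add_neg] using hf i j]
  simp only [sub_eq_add_neg]
  ring

lemma prod_neg_sub_eq {n : ℕ} (x : ℂ) (f : Fin n → ℂ) :
    ∏ i, (-x - f i) = (-1) ^ n * ∏ i, (x + f i) := by
  rw [← Fin.prod_const, ← prod_mul_distrib]
  exact prod_congr rfl fun i _ => by ring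

lemma prod_sub_rev_eq {n : ℕ} (x : ℂ) (f : Fin n → ℂ) :
    ∏ i, (f i - x) = (-1) ^ n * ∏ i, (x - f i) := by
  rw [← Fin.prod_const, ← prod_mul_distrib]
  exact prod_congr rfl fun i _ => by ring

/-- Products over the fibre of `R(w)` of the denominators of `R(-·)`. -/
lemma prod_prod_sub_eq (hR : ∀ z, R z = z - c * ∑ k, ρ k / (ε k + z))
    (hεε : ∀ i k, ε i + ε k ≠ 0) {n : ℕ} (u : ℂ) (f : Fin n → ℂ)
    (hf : ∀ v, levelPoly c ε ρ u v = ∏ i, (v - f i)) :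
    ∏ j, ∏ i, (ε i - f j)
      = (-1) ^ d * (∏ l, (u - R (ε l))) * ∏ l, ∏ i, (ε i + ε l) := by
  rw [prod_comm, ← prod_sub_rev_eq, ← prod_mul_distrib]
  refine prod_congr rfl fun l _ => ?_
  rw [← hf, sub_mul_prod_eq_levelPoly hR u (ε l) fun i => hεε i l]

/-- Partial fraction decomposition of `∏ᵢ (u - bᵢ) / ∏ₖ (u - eₖ)`. -/
lemma prod_sub_div_prod_sub_eq (e b : Fin d → ℂ) (he : Function.Injective e) (u : ℂ)
    (hu : ∀ k, u - e k ≠ 0) :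
    (∏ i, (u - b i)) / ∏ k, (u - e k)
      = 1 + ∑ k, (∏ i, (e k - b i)) / (∏ j ∈ univ.erase k, (e k - e j)) / (u - e k) := by
  have hinj : Set.InjOn e (univ : Finset (Fin d)) := he.injOn
  have hD : ∏ k, (u - e k) ≠ 0 := prod_ne_zero_iff.mpr fun k _ => hu k
  let P : Polynomial ℂ := Lagrange.nodal univ b - Lagrange.nodal univ e
  have hdeg : P.degree < (univ : Finset (Fin d)).card := by
    rw [← Lagrange.degree_nodal (v := b)]
    refine Polynomial.degree_sub_lt_left ?_ Lagrange.nodal_ne_zero ?_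
    · rw [Lagrange.degree_nodal, Lagrange.degree_nodal]
    · rw [Lagrange.nodal_monic.leadingCoeff, Lagrange.nodal_monic.leadingCoeff]
  have hP := congrArg (Polynomial.eval u) (Lagrange.eq_interpolate hinj hdeg)
  rw [Lagrange.eval_interpolate_not_at_node _ fun k _ => sub_ne_zero.mp (hu k)] at hP
  have hPe : ∀ k, P.eval (e k) = ∏ i, (e k - b i) := by
    intro k
    rw [Polynomial.eval_sub, Lagrange.eval_nodal_at_node (mem_univ k), Lagrange.eval_nodal, sub_zero]
  simp only [hPe] at hP
  simp only [P, Polynomial.eval_sub, Lagrange.eval_nodal] at hP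
  have hsum : ∑ k, (∏ i, (e k - b i)) / (∏ j ∈ univ.erase k, (e k - e j)) / (u - e k)
      = ∑ k, Lagrange.nodalWeight univ e k * (u - e k)⁻¹ * ∏ i, (e k - b i) := by
    refine sum_congr rfl fun k _ => ?_
    rw [Lagrange.nodalWeight, prod_inv_distrib]
    ring
  rw [div_eq_iff hD, hsum]
  linear_combination hP

/-- The coefficients of the explicit formula as products over the fibre of `R(w)`. -/
lemma coeff_mul_prod_eq (hR : ∀ z, R z = z - c * ∑ k, ρ k / (ε k + z))
    (hεε : ∀ i k, ε i + ε k ≠ 0) (k : Fin d) (b : Fin d → ℂ)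
    (hb : ∀ v, levelPoly c ε ρ (R (ε k)) v = (v - ε k) * ∏ j, (v - b j))
    (hεb : ∀ i j, ε i - b j ≠ 0) (u : ℂ) (f : Fin (d + 1) → ℂ)
    (hf : ∀ v, levelPoly c ε ρ u v = ∏ i, (v - f i)) (hεf : ∀ i j, ε i - f j ≠ 0) :
    -(c * (ρ k * deriv R (ε k))) * (∏ j ∈ univ.erase k, (R (ε k) - R (ε j)))
        * ∏ j, (u - R (-b j))
      = (∏ i, (R (ε k) - R (-f i))) * ∏ j, (u - R (ε j)) := by
  have hs : ((-1 : ℂ) ^ d) * (-1) ^ d = 1 := by rw [← mul_pow]; simp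
  have hB : ∏ l, ∏ i, (ε i + ε l) ≠ 0 :=
    prod_ne_zero_iff.mpr fun l _ => prod_ne_zero_iff.mpr fun i _ => hεε i l
  have h1 : (∏ j, (u - R (-b j))) * ∏ j, ∏ i, (ε i - b j)
      = ((-1) ^ d) ^ d * ∏ i, ∏ j, (f i + b j) := by
    rw [prod_sub_mul_prod_eq hR b hεb u, prod_comm (s := univ (α := Fin (d + 1))),
      ← Fin.prod_const, ← prod_mul_distrib]
    refine prod_congr rfl fun j _ => ?_
    rw [hf, prod_neg_sub_eq, pow_succ]
    simp [add_comm]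
  have h2 : (∏ i, (R (ε k) - R (-f i))) * ∏ j, ∏ i, (ε i - f j)
      = (∏ i, (ε k + f i)) * (((-1) ^ d) ^ (d + 1) * ∏ i, ∏ j, (f i + b j)) := by
    rw [prod_sub_mul_prod_eq hR f hεf, ← Fin.prod_const, ← prod_mul_distrib,
      ← prod_mul_distrib]
    refine prod_congr rfl fun i _ => ?_
    rw [hb, prod_neg_sub_eq]
    ring
  have h3 := hf (-ε k)
  rw [levelPoly_neg, prod_neg_sub_eq, pow_succ] at h3
  have h4 := prod_prod_sub_eq hR hεε u f hf
  have h5 : (∏ j, ∏ i, (ε i - b j)) * ∏ i ∈ univ.erase k, (ε i - ε k)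
      = (∏ i ∈ univ.erase k, (R (ε i) - R (ε k))) * deriv R (ε k)
        * ∏ l, ∏ i, (ε i + ε l) := by
    rw [prod_comm, ← mul_prod_erase univ _ (mem_univ k),
      ← mul_prod_erase univ (fun l => ∏ i, (ε i + ε l)) (mem_univ k),
      ← deriv_mul_prod_eq hR (ε k) (fun i => hεε i k) b hb]
    have : (∏ l ∈ univ.erase k, ∏ j, (ε l - b j)) * ∏ i ∈ univ.erase k, (ε i - ε k)
        = (∏ i ∈ univ.erase k, (R (ε i) - R (ε k)))
          * ∏ l ∈ univ.erase k, ∏ i, (ε i + ε l) := by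
      rw [← prod_mul_distrib, ← prod_mul_distrib]
      refine prod_congr rfl fun l _ => ?_
      rw [sub_mul_prod_eq_levelPoly hR _ (ε l) fun i => hεε i l, hb, mul_comm]
    linear_combination (deriv R (ε k) * ∏ i, (ε i + ε k)) * this
  have h6 : ∏ j ∈ univ.erase k, (R (ε k) - R (ε j))
      = -(-1) ^ d * ∏ i ∈ univ.erase k, (R (ε i) - R (ε k)) := by
    have hcard : (univ.erase k).card + 1 = d := by
      rw [card_erase_add_one (mem_univ k), card_univ, Fintype.card_fin]
    have hpow : -(-1 : ℂ) ^ d = (-1) ^ (univ.erase k).card := by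
      conv_lhs => rw [← hcard, pow_succ]
      ring
    rw [hpow, ← prod_const, ← prod_mul_distrib]
    exact prod_congr rfl fun i _ => by ring
  rw [h6]
  rw [h4] at h2
  rw [pow_succ] at h2
  generalize (∏ j, ∏ i, (ε i - b j)) = H at *
  generalize (∏ l, ∏ i, (ε i + ε l)) = B at *
  generalize (∏ i, ∏ j, (f i + b j)) = M at *
  generalize (∏ i, (ε k + f i)) = F at *
  generalize (∏ i, (R (ε k) - R (-f i))) = X at *
  generalize (∏ j, (u - R (-b j))) = a at *
  generalize (∏ j, (u - R (ε j))) = W at *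
  generalize (∏ i ∈ univ.erase k, (R (ε i) - R (ε k))) = E at *
  generalize (∏ i ∈ univ.erase k, (ε i - ε k)) = D at *
  generalize deriv R (ε k) = R' at *
  generalize ((-1 : ℂ) ^ d) = s at *
  generalize s ^ d = t at *
  refine mul_right_cancel₀ hB ?_
  -- `X W B = s F s t M = F a H` and `F = s c ρ D`
  linear_combination (-s) * h2 + (X * W * B - F * t * M) * hs - c * ρ k * s * a * h5 + F * h1
    + (-s) * a * H * h3 + a * H * F * hs

lemma prod_sub_symm (hR : ∀ z, R z = z - c * ∑ k, ρ k / (ε k + z))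
    (hεε : ∀ i k, ε i + ε k ≠ 0) (u w : ℂ) (f g : Fin (d + 1) → ℂ)
    (hf : ∀ v, levelPoly c ε ρ u v = ∏ i, (v - f i)) (hεf : ∀ i j, ε i - f j ≠ 0)
    (hg : ∀ v, levelPoly c ε ρ w v = ∏ i, (v - g i)) (hεg : ∀ i j, ε i - g j ≠ 0) :
    (∏ j, (u - R (-g j))) * ∏ l, (w - R (ε l)) = (∏ j, (w - R (-f j))) * ∏ l, (u - R (ε l)) := by
  have hB : ∏ l, ∏ i, (ε i + ε l) ≠ 0 :=
    prod_ne_zero_iff.mpr fun l _ => prod_ne_zero_iff.mpr fun i _ => hεε i l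
  have h1 := prod_sub_mul_prod_eq hR g hεg u
  have h2 := prod_sub_mul_prod_eq hR f hεf w
  rw [prod_prod_sub_eq hR hεε w g hg] at h1
  rw [prod_prod_sub_eq hR hεε u f hf] at h2
  have h3 : ∏ j, -levelPoly c ε ρ u (-g j) = ∏ j, -levelPoly c ε ρ w (-f j) := by
    simp only [hf, hg, prod_neg_sub_eq, prod_mul_distrib, prod_neg]
    rw [prod_comm]
    simp only [add_comm]
  have hs : ((-1 : ℂ) ^ d) ≠ 0 := by simp
  refine mul_right_cancel₀ (mul_ne_zero hs hB) ?_
  linear_combination h1 - h2 + h3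

/-- Product form of the explicit formula. -/
lemma one_sub_sum_eq_prod_div (hR : ∀ z, R z = z - c * ∑ k, ρ k / (ε k + z))
    (hεε : ∀ i k, ε i + ε k ≠ 0)
    (he : Function.Injective fun k => R (ε k)) (b : Fin d → Fin d → ℂ)
    (hb : ∀ k v, levelPoly c ε ρ (R (ε k)) v = (v - ε k) * ∏ j, (v - b k j))
    (hεb : ∀ k i j, ε i - b k j ≠ 0) (z w : ℂ) (f : Fin (d + 1) → ℂ) (hf0 : f 0 = w)
    (hf : ∀ v, levelPoly c ε ρ (R w) v = ∏ i, (v - f i)) (hεf : ∀ i j, ε i - f j ≠ 0)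
    (hz : ∀ k, R z - R (ε k) ≠ 0) (hw : ∀ k, R w - R (ε k) ≠ 0)
    (hw' : ∀ k, R (ε k) - R (-w) ≠ 0) :
    1 - c * ∑ k, ρ k * deriv R (ε k) / ((R z - R (ε k)) * (R (ε k) - R (-w)))
        * ∏ j, (R w - R (-b k j)) / (R w - R (ε j))
      = (∏ i : Fin d, (R z - R (-f i.succ))) / ∏ k, (R z - R (ε k)) := by
  rw [prod_sub_div_prod_sub_eq (fun k => R (ε k)) _ he (R z) hz, sub_eq_add_neg, mul_sum,
    ← sum_neg_distrib]
  congr 1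
  refine sum_congr rfl fun k _ => ?_
  have hkey := coeff_mul_prod_eq hR hεε k (b k) (hb k) (hεb k) (R w) f hf hεf
  rw [Fin.prod_univ_succ, hf0] at hkey
  have hW : ∏ j, (R w - R (ε j)) ≠ 0 := prod_ne_zero_iff.mpr fun j _ => hw j
  have hE : ∏ j ∈ univ.erase k, (R (ε k) - R (ε j)) ≠ 0 :=
    prod_ne_zero_iff.mpr fun j hj => sub_ne_zero.mpr fun h => (mem_erase.mp hj).1 (he h).symm
  have hzk := hz k
  have hwk := hw' k
  rw [prod_div_distrib]
  field_simp
  linear_combination hkey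

end levelPoly

/-- For `R(z) = z - (λ/N) ∑ₖ ϱₖ/(εₖ + z)` with `e k := R (ε k)` pairwise
distinct, `r k := ϱ k · R'(ε k)`, other preimages `ε̂ₖʲ` of `R(εₖ)` determined by
`(R(v) − R(εₖ))·∏ᵢ(εᵢ+v) = (v−εₖ)·∏ⱼ(v−ε̂ₖʲ)`, the explicit solution formula `𝒢` is
symmetric, `𝒢(z,w) = 𝒢(w,z)`, at all points where every denominator occurring in both
expressions is nonzero. -/
theorem stmt_2
    (d : ℕ) (hd : 1 ≤ d) (lam N : ℝ) (hlam : lam ≠ 0) (hN : 0 < N)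
    (ε : Fin d → ℂ) (hε : Function.Injective ε)
    (ϱ : Fin d → ℝ) (hϱ : ∀ k, ϱ k ≠ 0)
    (R : ℂ → ℂ)
    (hR : ∀ z : ℂ, R z = z - ((lam / N : ℝ) : ℂ) * ∑ k : Fin d, (ϱ k : ℂ) / (ε k + z))
    (e : Fin d → ℂ) (he_def : ∀ k, e k = R (ε k))
    (r : Fin d → ℂ) (hr_def : ∀ k, r k = (ϱ k : ℂ) * deriv R (ε k))
    (he : Function.Injective e)
    (εhat : Fin d → Fin d → ℂ)
    (hεhat : ∀ k, ∀ v : ℂ, (∀ i, ε i + v ≠ 0) →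
      (R v - R (ε k)) * ∏ i : Fin d, (ε i + v)
        = (v - ε k) * ∏ j : Fin d, (v - εhat k j))
    (G : ℂ → ℂ → ℂ)
    (hG : ∀ z w : ℂ, G z w =
      (1 - ((lam / N : ℝ) : ℂ) * ∑ k : Fin d,
          r k / ((R z - R (ε k)) * (R (ε k) - R (-w)))
            * ∏ j : Fin d, (R w - R (-(εhat k j))) / (R w - R (ε j)))
        / (R w - R (-z))) :
    ∀ z w : ℂ,
      (∀ k, ε k + z ≠ 0) → (∀ k, ε k - z ≠ 0) →
      (∀ k, ε k + w ≠ 0) → (∀ k, ε k - w ≠ 0) →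
      (∀ k i j, ε i - εhat k j ≠ 0) →
      (∀ k, R z - R (ε k) ≠ 0) → (∀ k, R w - R (ε k) ≠ 0) →
      (∀ k, R (ε k) - R (-w) ≠ 0) → (∀ k, R (ε k) - R (-z) ≠ 0) →
      (R w - R (-z) ≠ 0) → (R z - R (-w) ≠ 0) →
      G z w = G w z := by
  intro z w hz hz' hw hw' hεb hRz hRw hRw' hRz' hwz hzw
  obtain rfl : e = fun k => R (ε k) := funext he_def
  have hc : ((lam / N : ℝ) : ℂ) ≠ 0 := by
    exact_mod_cast div_ne_zero hlam hN.ne'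
  generalize ((lam / N : ℝ) : ℂ) = c at *
  have hρ : ∀ k, (ϱ k : ℂ) ≠ 0 := fun k => by exact_mod_cast hϱ k
  generalize hρ_def : (fun k => (ϱ k : ℂ)) = ρ at *
  have hρk : ∀ k, (ϱ k : ℂ) = ρ k := fun k => congrFun hρ_def k
  simp only [hρk] at *
  have hb : ∀ k v, levelPoly c ε ρ (R (ε k)) v = (v - ε k) * ∏ j, (v - εhat k j) :=
    fun k => levelPoly_eq_of_forall_ne hR _ _ _ (hεhat k)
  have hεε : ∀ i k, ε i + ε k ≠ 0 := fun i k =>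
    add_ne_zero_of_levelPoly_eq_zero hc hρ hε (u := R (ε k)) (by rw [hb]; ring) i
  have hroot : ∀ x, (∀ k, ε k + x ≠ 0) → (∀ k, R x - R (ε k) ≠ 0) →
      ∃ f : Fin (d + 1) → ℂ, f 0 = x ∧ (∀ v, levelPoly c ε ρ (R x) v = ∏ i, (v - f i)) ∧
        ∀ i j, ε i - f j ≠ 0 := by
    intro x hx hRx
    obtain ⟨f, hf0, hf⟩ := exists_levelPoly_eq_prod (c := c) (ε := ε) (ρ := ρ) (R x) x
      (by rw [← sub_mul_prod_eq_levelPoly hR _ _ hx]; ring)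
    refine ⟨f, hf0, hf, fun i => ?_⟩
    have h : ∏ j, (ε i - f j) ≠ 0 := by
      rw [← hf, ← sub_mul_prod_eq_levelPoly hR _ _ fun l => hεε l i]
      refine mul_ne_zero ?_ (prod_ne_zero_iff.mpr fun l _ => hεε l i)
      rw [← neg_sub]
      exact neg_ne_zero.mpr (hRx i)
    exact fun j => prod_ne_zero_iff.mp h j (mem_univ j)
  obtain ⟨f, hf0, hf, hεf⟩ := hroot z hz hRz
  obtain ⟨g, hg0, hg, hεg⟩ := hroot w hw hRw
  have hsymm := prod_sub_symm hR hεε (R z) (R w) f g hf hεf hg hεg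
  rw [Fin.prod_univ_succ, Fin.prod_univ_succ (fun j => R w - R (-f j)), hf0, hg0] at hsymm
  rw [hG, hG]
  simp only [hr_def]
  rw [one_sub_sum_eq_prod_div hR hεε he εhat hb hεb z w g hg0 hg hεg hRz hRw hRw',
    one_sub_sum_eq_prod_div hR hεε he εhat hb hεb w z f hf0 hf hεf hRw hRz hRz']
  have hZ : ∏ k, (R z - R (ε k)) ≠ 0 := prod_ne_zero_iff.mpr fun k _ => hRz k
  have hW : ∏ k, (R w - R (ε k)) ≠ 0 := prod_ne_zero_iff.mpr fun k _ => hRw k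
  field_simp
  linear_combination hsymm
end

section
/- Fix an integer d ≥ 1, real numbers λ ≠ 0 and N > 0, pairwise distinct reals e_1,…,e_d > 0 and reals r_1,…,r_d > 0. Let U ⊆ ℂ be a set containing points ε_1,…,ε_d, let R be a function defined on U ∪ (−U) with R(ε_k) = e_k for all k, and let G be a function of two complex variables satisfying the nonlinear equation (ζ+η)·G(ζ,η) = 1 − (λ/N)·Σ_{k=1}^d r_k·( G(ζ,η)·G(ζ,e_k) − (G(e_k,η) − G(ζ,η))/(e_k − ζ) ) for all ζ, η in R(U) with ζ ∉ {e_1,…,e_d}. Define 𝒢(z,w) := G(R(z),R(w)) and suppose that the ansatz equation R(z) + (λ/N)·Σ_{k=1}^d r_k·𝒢(z,ε_k) + (λ/N)·Σ_{k=1}^d r_k/(R(ε_k) − R(z)) = −R(−z) holds for all z ∈ U with R(z) ∉ {e_1,…,e_d}. Then the linear equation (R(w) − R(−z))·𝒢(z,w) = 1 + (λ/N)·Σ_{k=1}^d r_k·𝒢(ε_k,w)/(R(ε_k) − R(z)) holds for all z, w ∈ U with R(z) ∉ {e_1,…,e_d}. -/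
open Finset

/-- If `G` satisfies the closed nonlinear Dyson–Schwinger equation for the
planar two-point function on `R(U)` (away from `e₁,…,e_d`), and `𝒢(z,w) := G(R(z),R(w))`
satisfies the ansatz equation defining `−R(−z)`, then `𝒢` satisfies the linear equation. -/
theorem stmt_3
    (d : ℕ) (hd : 1 ≤ d) (lam N : ℝ) (hlam : lam ≠ 0) (hN : 0 < N)
    (e : Fin d → ℝ) (hepos : ∀ k, 0 < e k) (hedist : Function.Injective e)
    (r : Fin d → ℝ) (hrpos : ∀ k, 0 < r k)
    (U : Set ℂ) (ε : Fin d → ℂ) (hεU : ∀ k, ε k ∈ U)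
    (R : ℂ → ℂ) (hRe : ∀ k, R (ε k) = (e k : ℂ))
    (G : ℂ → ℂ → ℂ)
    (hnonlin : ∀ ζ ∈ R '' U, ∀ η ∈ R '' U, (∀ k, ζ ≠ (e k : ℂ)) →
      (ζ + η) * G ζ η
        = 1 - ((lam / N : ℝ) : ℂ) * ∑ k : Fin d, (r k : ℂ) *
            (G ζ η * G ζ (e k : ℂ)
              - (G (e k : ℂ) η - G ζ η) / ((e k : ℂ) - ζ)))
    (hansatz : ∀ z ∈ U, (∀ k, R z ≠ (e k : ℂ)) →
      R z + ((lam / N : ℝ) : ℂ) * ∑ k : Fin d, (r k : ℂ) * G (R z) (R (ε k))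
        + ((lam / N : ℝ) : ℂ) * ∑ k : Fin d, (r k : ℂ) / (R (ε k) - R z)
        = -R (-z)) :
    ∀ z ∈ U, ∀ w ∈ U, (∀ k, R z ≠ (e k : ℂ)) →
      (R w - R (-z)) * G (R z) (R w)
        = 1 + ((lam / N : ℝ) : ℂ) * ∑ k : Fin d,
            (r k : ℂ) * G (R (ε k)) (R w) / (R (ε k) - R z) := by
  intro z hz w hw hzne
  have hnl := hnonlin (R z) ⟨z, hz, rfl⟩ (R w) ⟨w, hw, rfl⟩ hzne
  have han := hansatz z hz hzne
  simp only [hRe] at han ⊢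
  have hsplit : ∑ k : Fin d, (r k : ℂ) * (G (R z) (R w) * G (R z) (e k : ℂ)
        - (G (e k : ℂ) (R w) - G (R z) (R w)) / ((e k : ℂ) - R z))
      = G (R z) (R w) * ∑ k : Fin d, (r k : ℂ) * G (R z) (e k : ℂ)
        - ∑ k : Fin d, (r k : ℂ) * G (e k : ℂ) (R w) / ((e k : ℂ) - R z)
        + G (R z) (R w) * ∑ k : Fin d, (r k : ℂ) / ((e k : ℂ) - R z) := by
    rw [Finset.mul_sum, Finset.mul_sum, ← Finset.sum_sub_distrib, ← Finset.sum_add_distrib]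
    exact Finset.sum_congr rfl fun k _ => by ring
  rw [hsplit] at hnl
  linear_combination hnl - G (R z) (R w) * han
end

section
/- Let θ > 0. For all natural numbers k, l, the matrix-basis functions satisfy ∫_{ℝ²} f_{kl}(x₁,x₂) dx₁ dx₂ = 2πθ·δ_{kl}, where δ_{kl} is the Kronecker delta. -/
open Finset MeasureTheory

/-- Associated Laguerre polynomial
`L_n^α(x) = ∑_{i=0}^n (−1)^i · binom(n+α, n−i) · x^i / i!` (natural parameter `α`). -/
noncomputable def laguerreL (n α : ℕ) (x : ℝ) : ℝ :=
  ∑ i ∈ Finset.range (n + 1),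
    (-1 : ℝ) ^ i * (Nat.choose (n + α) (n - i) : ℝ) * x ^ i / (Nat.factorial i : ℝ)

/-- The matrix-basis function `f_{kl}` on `ℝ²` for `k ≤ l`:
`f_{kl}(x₁,x₂) = 2(−1)^k √(k!/l!) (x₁+ix₂)^{l−k} L_k^{l−k}((2x₁²+2x₂²)/θ) e^{−(x₁²+x₂²)/θ}`. -/
noncomputable def moyalBasisAux (θ : ℝ) (k l : ℕ) (x : ℝ × ℝ) : ℂ :=
  2 * (-1 : ℂ) ^ k * (Real.sqrt ((Nat.factorial k : ℝ) / (Nat.factorial l : ℝ)) : ℂ)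
    * ((x.1 : ℂ) + (x.2 : ℂ) * Complex.I) ^ (l - k)
    * ((laguerreL k (l - k) ((2 * x.1 ^ 2 + 2 * x.2 ^ 2) / θ) : ℝ) : ℂ)
    * ((Real.exp (-(x.1 ^ 2 + x.2 ^ 2) / θ) : ℝ) : ℂ)

/-- The matrix-basis function `f_{kl}` on `ℝ²`; for `k > l` it is the complex conjugate
of `f_{lk}`. -/
noncomputable def moyalBasis (θ : ℝ) (k l : ℕ) (x : ℝ × ℝ) : ℂ :=
  if k ≤ l then moyalBasisAux θ k l x else starRingEnd ℂ (moyalBasisAux θ l k x)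

/-- The integral over `ℝ²` of `z ^ n` times a radial function splits into a radial and an
angular factor. -/
theorem integral_pow_mul_radial (n : ℕ) (g : ℝ → ℂ) :
    ∫ x : ℝ × ℝ, ((x.1 : ℂ) + (x.2 : ℂ) * Complex.I) ^ n * g (x.1 ^ 2 + x.2 ^ 2)
      = (∫ r in Set.Ioi (0 : ℝ), (r : ℂ) ^ (n + 1) * g (r ^ 2))
        * ∫ φ in Set.Ioo (-Real.pi) Real.pi, Complex.exp (n * Complex.I * φ) := by
  rw [← integral_comp_polarCoord_symm, polarCoord_target, Measure.volume_eq_prod,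
    ← setIntegral_prod_mul]
  refine setIntegral_congr_fun (measurableSet_Ioi.prod measurableSet_Ioo) fun p _ => ?_
  have hz : (((p.1 * Real.cos p.2 : ℝ) : ℂ) + ((p.1 * Real.sin p.2 : ℝ) : ℂ) * Complex.I)
      = p.1 * Complex.exp (p.2 * Complex.I) := by
    rw [Complex.exp_mul_I]
    push_cast
    ring
  have hr : (p.1 * Real.cos p.2) ^ 2 + (p.1 * Real.sin p.2) ^ 2 = p.1 ^ 2 := by
    linear_combination p.1 ^ 2 * Real.sin_sq_add_cos_sq p.2
  have he : Complex.exp (n * Complex.I * p.2) = Complex.exp (p.2 * Complex.I) ^ n := by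
    rw [← Complex.exp_nat_mul]
    ring_nf
  simp only [polarCoord_symm_apply, hz, hr, he, Complex.real_smul]
  ring

theorem setIntegral_exp_nat_mul_I (n : ℕ) :
    ∫ φ in Set.Ioo (-Real.pi) Real.pi, Complex.exp (n * Complex.I * φ)
      = if n = 0 then ((2 * Real.pi : ℝ) : ℂ) else 0 := by
  rw [← integral_Ioc_eq_integral_Ioo,
    ← intervalIntegral.integral_of_le (by linarith [Real.pi_pos])]
  split_ifs with h
  · simp [h]
    ring
  · have hn : (n : ℂ) * Complex.I ≠ 0 := mul_ne_zero (by exact_mod_cast h) Complex.I_ne_zero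
    have hperiod : Complex.exp (n * Complex.I * (Real.pi : ℝ))
        = Complex.exp (n * Complex.I * (-Real.pi : ℝ)) := by
      rw [Complex.exp_eq_exp_iff_exists_int]
      refine ⟨n, ?_⟩
      push_cast
      ring
    rw [integral_exp_mul_complex hn, hperiod, sub_self, zero_div]

theorem integrableOn_pow_mul_exp_neg_sq_div {θ : ℝ} (hθ : 0 < θ) (n : ℕ) :
    IntegrableOn (fun r : ℝ => r ^ n * Real.exp (-r ^ 2 / θ)) (Set.Ioi 0) := by
  have h := integrableOn_rpow_mul_exp_neg_mul_sq (b := θ⁻¹) (inv_pos.2 hθ) (s := n)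
    (by linarith [n.cast_nonneg (α := ℝ)])
  refine h.congr_fun (fun r _ => ?_) measurableSet_Ioi
  simp only [Real.rpow_natCast]
  ring_nf

theorem integral_pow_odd_mul_exp_neg_sq_div {θ : ℝ} (hθ : 0 < θ) (i : ℕ) :
    ∫ r in Set.Ioi (0 : ℝ), r ^ (2 * i + 1) * Real.exp (-r ^ 2 / θ)
      = θ ^ (i + 1) * (i.factorial : ℝ) / 2 := by
  have h := integral_rpow_mul_exp_neg_mul_rpow (p := 2) (q := (2 * i + 1 : ℕ)) (b := θ⁻¹)
    two_pos (by linarith [(2 * i + 1).cast_nonneg (α := ℝ)]) (inv_pos.2 hθ)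
  have hq : (((2 * i + 1 : ℕ) : ℝ) + 1) / 2 = (i : ℝ) + 1 := by
    push_cast
    ring
  have hpow : θ⁻¹ ^ (-((i : ℝ) + 1)) = θ ^ (i + 1) := by
    rw [Real.rpow_neg (inv_pos.2 hθ).le, Real.inv_rpow hθ.le, inv_inv]
    exact_mod_cast Real.rpow_natCast θ (i + 1)
  rw [neg_div, hq, Real.Gamma_nat_eq_factorial, hpow] at h
  rw [mul_div_right_comm, ← mul_one_div (θ ^ (i + 1)), ← h]
  refine setIntegral_congr_fun measurableSet_Ioi fun r _ => ?_
  simp only [Real.rpow_natCast, Real.rpow_two]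
  ring_nf

theorem integral_mul_laguerreL_mul_exp {θ : ℝ} (hθ : 0 < θ) (k : ℕ) :
    ∫ r in Set.Ioi (0 : ℝ), r * (laguerreL k 0 (2 * r ^ 2 / θ) * Real.exp (-r ^ 2 / θ))
      = (-1) ^ k * θ / 2 := by
  have hsum : ∀ r : ℝ, r * (laguerreL k 0 (2 * r ^ 2 / θ) * Real.exp (-r ^ 2 / θ))
      = ∑ i ∈ Finset.range (k + 1),
        ((-1) ^ i * (Nat.choose k i : ℝ) * (2 / θ) ^ i / (i.factorial : ℝ))
          * (r ^ (2 * i + 1) * Real.exp (-r ^ 2 / θ)) := by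
    intro r
    rw [laguerreL, Finset.sum_mul, Finset.mul_sum]
    refine Finset.sum_congr rfl fun i hi => ?_
    rw [add_zero, Nat.choose_symm (Nat.lt_succ_iff.1 (Finset.mem_range.1 hi)),
      mul_div_right_comm (2 : ℝ), mul_pow]
    ring
  simp only [hsum]
  rw [integral_finsetSum _ fun i _ =>
    (integrableOn_pow_mul_exp_neg_sq_div hθ (2 * i + 1)).const_mul _]
  simp only [integral_const_mul, integral_pow_odd_mul_exp_neg_sq_div hθ]
  have hbinom : ((-1 : ℝ)) ^ k
      = ∑ i ∈ Finset.range (k + 1), (-2 : ℝ) ^ i * (Nat.choose k i : ℝ) := by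
    have h := add_pow (-2 : ℝ) 1 k
    norm_num at h
    exact h
  rw [hbinom, mul_div_assoc, Finset.sum_mul]
  refine Finset.sum_congr rfl fun i _ => ?_
  have hi : (i.factorial : ℝ) ≠ 0 := by exact_mod_cast i.factorial_ne_zero
  rw [show (-2 : ℝ) = -1 * 2 by norm_num, mul_pow, div_pow, pow_succ]
  field_simp

theorem integral_moyalBasisAux {θ : ℝ} (hθ : 0 < θ) {k l : ℕ} (hkl : k ≤ l) :
    ∫ x : ℝ × ℝ, moyalBasisAux θ k l x
      = if k = l then ((2 * Real.pi * θ : ℝ) : ℂ) else 0 := by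
  let g : ℝ → ℂ := fun s => ((laguerreL k (l - k) (2 * s / θ) * Real.exp (-s / θ) : ℝ) : ℂ)
  have hfactor : ∀ x : ℝ × ℝ, moyalBasisAux θ k l x
      = (2 * (-1 : ℂ) ^ k * (Real.sqrt ((k.factorial : ℝ) / (l.factorial : ℝ)) : ℂ))
        * (((x.1 : ℂ) + (x.2 : ℂ) * Complex.I) ^ (l - k)
          * g (x.1 ^ 2 + x.2 ^ 2)) := by
    intro x
    simp only [moyalBasisAux, g, mul_add, Complex.ofReal_mul, mul_assoc]
  simp only [hfactor]
  rw [integral_const_mul, integral_pow_mul_radial _ g, setIntegral_exp_nat_mul_I]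
  rcases hkl.eq_or_lt with rfl | hlt
  · have hk : (k.factorial : ℝ) ≠ 0 := by exact_mod_cast k.factorial_ne_zero
    simp only [g, Nat.sub_self, zero_add, pow_one, if_true, div_self hk, Real.sqrt_one,
      ← Complex.ofReal_mul]
    rw [integral_complex_ofReal, integral_mul_laguerreL_mul_exp hθ]
    have hsign : ((-1 : ℂ) ^ k) * (-1) ^ k = 1 := by rw [← mul_pow]; simp
    push_cast
    linear_combination (2 * Real.pi * θ : ℂ) * hsign
  · rw [if_neg (Nat.sub_ne_zero_of_lt hlt), if_neg hlt.ne, mul_zero, mul_zero]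

/-- `∫_{ℝ²} f_{kl} = 2πθ·δ_{kl}`. -/
theorem stmt_5 (θ : ℝ) (hθ : 0 < θ) (k l : ℕ) :
    ∫ x : ℝ × ℝ, moyalBasis θ k l x
      = if k = l then ((2 * Real.pi * θ : ℝ) : ℂ) else 0 := by
  unfold moyalBasis
  split_ifs with hle heq heq
  · rw [integral_moyalBasisAux hθ hle, if_pos heq]
  · rw [integral_moyalBasisAux hθ hle, if_neg heq]
  · exact absurd heq.le hle
  · rw [integral_conj, integral_moyalBasisAux hθ (not_le.1 hle).le, if_neg (Ne.symm heq), map_zero]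
end

section
/- Let θ > 0. For all natural numbers k, l and all (x₁,x₂) ∈ ℝ², the matrix-basis functions are eigenfunctions of the harmonic-oscillator Hamiltonian: −(∂²f_{kl}/∂x₁²)(x₁,x₂) − (∂²f_{kl}/∂x₂²)(x₁,x₂) + (4/θ²)·(x₁² + x₂²)·f_{kl}(x₁,x₂) = (4/θ)·(k + l + 1)·f_{kl}(x₁,x₂). -/
open Finset MeasureTheory

open Polynomial in
/-- The associated Laguerre polynomial with complex coefficients. -/
noncomputable def laguerrePoly (n α : ℕ) : ℂ[X] :=
  ∑ i ∈ Finset.range (n + 1),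
    C ((-1 : ℂ) ^ i * (Nat.choose (n + α) (n - i) : ℂ) / (Nat.factorial i : ℂ)) * X ^ i

theorem eval_laguerrePoly (n α : ℕ) (x : ℝ) :
    (laguerrePoly n α).eval (x : ℂ) = (laguerreL n α x : ℂ) := by
  simp only [laguerrePoly, laguerreL, Polynomial.eval_finsetSum, Polynomial.eval_mul,
    Polynomial.eval_C, Polynomial.eval_pow, Polynomial.eval_X]
  push_cast
  exact Finset.sum_congr rfl fun i _ => by ring

theorem coeff_laguerrePoly (n α i : ℕ) :
    (laguerrePoly n α).coeff i =
      if i < n + 1 then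
        (-1 : ℂ) ^ i * (Nat.choose (n + α) (n - i) : ℂ) / (Nat.factorial i : ℂ) else 0 := by
  simp [laguerrePoly, Polynomial.finsetSum_coeff, Polynomial.coeff_X_pow]

theorem coeff_laguerrePoly_succ (n α i : ℕ) :
    ((i : ℂ) + 1) * (i + α + 1) * (laguerrePoly n α).coeff (i + 1)
      + ((n : ℂ) - i) * (laguerrePoly n α).coeff i = 0 := by
  rw [coeff_laguerrePoly, coeff_laguerrePoly]
  rcases lt_trichotomy i n with h | rfl | h
  · obtain ⟨j, rfl⟩ : ∃ j, n = i + 1 + j := ⟨n - (i + 1), by omega⟩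
    have hc := Nat.choose_succ_right_eq (i + 1 + j + α) j
    rw [show i + 1 + j + α - j = i + α + 1 by omega] at hc
    have hc' : ((i + 1 + j + α).choose (j + 1) : ℂ) * (j + 1)
        = ((i + 1 + j + α).choose j : ℂ) * (i + α + 1) := by exact_mod_cast hc
    have hf : (Nat.factorial i : ℂ) ≠ 0 := by exact_mod_cast i.factorial_ne_zero
    have hi : (i : ℂ) + 1 ≠ 0 := by exact_mod_cast i.succ_ne_zero
    rw [if_pos (by omega), if_pos (by omega), show i + 1 + j - (i + 1) = j by omega,
      show i + 1 + j - i = j + 1 by omega, Nat.factorial_succ]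
    push_cast
    field_simp
    linear_combination (-1 : ℂ) ^ i * hc'
  · simp
  · rw [if_neg (by omega), if_neg (by omega)]
    simp

open Polynomial in
/-- The associated Laguerre differential equation. -/
theorem laguerrePoly_ode (n α : ℕ) :
    X * derivative (derivative (laguerrePoly n α))
      + ((α : ℂ[X]) + 1 - X) * derivative (laguerrePoly n α)
      + (n : ℂ[X]) * laguerrePoly n α = 0 := by
  ext i
  have h := coeff_laguerrePoly_succ n α i
  have e : ((α : ℂ[X]) + 1 - X) * derivative (laguerrePoly n α)
      = C ((α : ℂ) + 1) * derivative (laguerrePoly n α) - X * derivative (laguerrePoly n α) := by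
    simp only [map_add, map_natCast, map_one]; ring
  rw [e, ← map_natCast (C : ℂ →+* ℂ[X]) n]
  cases i with
  | zero =>
    simp only [coeff_add, coeff_sub, coeff_C_mul, coeff_X_mul_zero, coeff_derivative, coeff_zero]
    push_cast at h ⊢
    linear_combination h
  | succ i =>
    simp only [coeff_add, coeff_sub, coeff_C_mul, coeff_X_mul, coeff_derivative, coeff_zero]
    push_cast at h ⊢
    linear_combination h

open Polynomial in
theorem deriv_deriv_polynomial_mul_gaussian (P Q : ℂ[X]) (t α β c : ℂ) (x : ℝ) :
    deriv (deriv fun s : ℝ => Q.eval (α * s + β) * P.eval (2 * t * ((s : ℂ) ^ 2 + c))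
        * Complex.exp (-(t * ((s : ℂ) ^ 2 + c)))) x =
      let z := α * x + β
      let u := 2 * t * ((x : ℂ) ^ 2 + c)
      (α ^ 2 * (derivative (derivative Q)).eval z * P.eval u
        + 2 * α * (derivative Q).eval z
          * (4 * t * x * (derivative P).eval u - 2 * t * x * P.eval u)
        + Q.eval z * (16 * t ^ 2 * x ^ 2 * (derivative (derivative P)).eval u
          + (4 * t - 16 * t ^ 2 * x ^ 2) * (derivative P).eval u
          + (4 * t ^ 2 * x ^ 2 - 2 * t) * P.eval u))
        * Complex.exp (-(t * ((x : ℂ) ^ 2 + c))) := by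
  have hid (s : ℝ) : HasDerivAt (fun s : ℝ => (s : ℂ)) 1 s := Complex.ofRealCLM.hasDerivAt
  have hz (s : ℝ) : HasDerivAt (fun s : ℝ => α * (s : ℂ) + β) α s := by
    simpa using ((hid s).const_mul α).add_const β
  have hq (s : ℝ) : HasDerivAt (fun s : ℝ => (s : ℂ) ^ 2 + c) (2 * s) s := by
    simpa using ((hid s).pow 2).add_const c
  have hQ (R : ℂ[X]) (s : ℝ) : HasDerivAt (fun s : ℝ => R.eval (α * (s : ℂ) + β))
      ((derivative R).eval (α * (s : ℂ) + β) * α) s :=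
    (R.hasDerivAt _).comp s (hz s)
  have hP (R : ℂ[X]) (s : ℝ) : HasDerivAt (fun s : ℝ => R.eval (2 * t * ((s : ℂ) ^ 2 + c)))
      ((derivative R).eval (2 * t * ((s : ℂ) ^ 2 + c)) * (2 * t * (2 * s))) s :=
    (R.hasDerivAt _).comp s ((hq s).const_mul (2 * t))
  have hE (s : ℝ) : HasDerivAt (fun s : ℝ => Complex.exp (-(t * ((s : ℂ) ^ 2 + c))))
      (Complex.exp (-(t * ((s : ℂ) ^ 2 + c))) * -(t * (2 * s))) s :=
    ((hq s).const_mul t).neg.cexp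
  have h1 : (deriv fun s : ℝ => Q.eval (α * s + β) * P.eval (2 * t * ((s : ℂ) ^ 2 + c))
        * Complex.exp (-(t * ((s : ℂ) ^ 2 + c)))) = fun s : ℝ => _ :=
    funext fun s => (((hQ Q s).mul (hP P s)).mul (hE s)).deriv
  rw [h1]
  have hT (s : ℝ) (a : ℂ) : HasDerivAt (fun s : ℝ => a * (2 * (s : ℂ))) (a * 2) s := by
    simpa using ((hid s).const_mul 2).const_mul a
  have h2 := (((((hQ (derivative Q) x).mul_const α).mul (hP P x)).add
    ((hQ Q x).mul ((hP (derivative P) x).mul (hT x (2 * t))))).mul (hE x)).add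
    (((hQ Q x).mul (hP P x)).mul ((hE x).mul (hT x t).neg))
  refine Eq.trans h2.deriv ?_
  simp only [Pi.mul_apply, Pi.add_apply, Pi.neg_apply]
  ring

open Polynomial in
/-- The eigenvalue equation for `moyalBasisAux` (`ε = i`) and its conjugate (`ε = -i`) at once. -/
theorem laplacian_pow_mul_laguerre_mul_gaussian (a ε t : ℂ) (hε : ε ^ 2 = -1) (k m : ℕ)
    (f : ℝ × ℝ → ℂ)
    (hf : ∀ x y : ℝ, f (x, y) = a * ((X ^ m : ℂ[X]).eval ((x : ℂ) + ε * y)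
      * (laguerrePoly k m).eval (2 * t * ((x : ℂ) ^ 2 + (y : ℂ) ^ 2))
      * Complex.exp (-(t * ((x : ℂ) ^ 2 + (y : ℂ) ^ 2))))) (x y : ℝ) :
    -(deriv (deriv (fun s : ℝ => f (s, y))) x) - deriv (deriv (fun s : ℝ => f (x, s))) y
      + 4 * t ^ 2 * ((x : ℂ) ^ 2 + (y : ℂ) ^ 2) * f (x, y)
      = 4 * t * (2 * k + m + 1) * f (x, y) := by
  have hx := deriv_deriv_polynomial_mul_gaussian (laguerrePoly k m) (X ^ m) t 1 (ε * y) (y ^ 2) x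
  have hy := deriv_deriv_polynomial_mul_gaussian (laguerrePoly k m) (X ^ m) t ε x (x ^ 2) y
  have hfx : (fun s : ℝ => f (s, y)) = fun s : ℝ => a * ((X ^ m : ℂ[X]).eval (1 * (s : ℂ) + ε * y)
      * (laguerrePoly k m).eval (2 * t * ((s : ℂ) ^ 2 + (y : ℂ) ^ 2))
      * Complex.exp (-(t * ((s : ℂ) ^ 2 + (y : ℂ) ^ 2)))) := by
    funext s; rw [hf, one_mul]
  have hfy : (fun s : ℝ => f (x, s)) = fun s : ℝ => a * ((X ^ m : ℂ[X]).eval (ε * (s : ℂ) + x)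
      * (laguerrePoly k m).eval (2 * t * ((s : ℂ) ^ 2 + (x : ℂ) ^ 2))
      * Complex.exp (-(t * ((s : ℂ) ^ 2 + (x : ℂ) ^ 2)))) := by
    funext s; rw [hf, add_comm (x : ℂ), add_comm ((x : ℂ) ^ 2)]
  have hXm : (X : ℂ[X]) * derivative (X ^ m) = (m : ℂ[X]) * X ^ m := by
    cases m with
    | zero => simp
    | succ m => rw [derivative_X_pow]; simp; ring
  have hz := congrArg (eval ((x : ℂ) + ε * y)) hXm
  have hu := congrArg (eval (2 * t * ((x : ℂ) ^ 2 + (y : ℂ) ^ 2))) (laguerrePoly_ode k m)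
  rw [hfx, hfy]
  have hmul (g : ℝ → ℂ) (s : ℝ) :
      deriv (deriv fun r => a * g r) s = a * deriv (deriv g) s := by
    rw [show (deriv fun r => a * g r) = fun r => a * deriv g r from
      funext fun r => deriv_const_mul_field a, deriv_const_mul_field]
  rw [hmul, hmul, hx, hy, hf]
  simp only [one_mul, add_comm (ε * (y : ℂ)) (x : ℂ), add_comm ((y : ℂ) ^ 2) ((x : ℂ) ^ 2)]
  simp only [eval_mul, eval_add, eval_sub, eval_X, eval_natCast, eval_one, eval_zero] at hz hu
  generalize (laguerrePoly k m) = P at *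
  generalize (X ^ m : ℂ[X]) = Q at *
  generalize eval _ (derivative (derivative Q)) = Q₂ at *
  generalize eval _ (derivative Q) = Q₁ at *
  generalize eval _ Q = Q₀ at *
  generalize eval _ (derivative (derivative P)) = P₂ at *
  generalize eval _ (derivative P) = P₁ at *
  generalize eval _ P = P₀ at *
  generalize Complex.exp _ = E at *
  linear_combination (-a * E * Q₂ * P₀) * hε - a * E * 4 * t * (2 * P₁ - P₀) * hz
    - 8 * t * a * E * Q₀ * hu

/-- The matrix-basis functions are eigenfunctions of the
harmonic-oscillator Hamiltonian:
`−∂²f_{kl}/∂x₁² − ∂²f_{kl}/∂x₂² + (4/θ²)(x₁²+x₂²) f_{kl} = (4/θ)(k+l+1) f_{kl}`. -/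
theorem stmt_6 (θ : ℝ) (hθ : 0 < θ) (k l : ℕ) (x₁ x₂ : ℝ) :
    -(deriv (deriv (fun s : ℝ => moyalBasis θ k l (s, x₂))) x₁)
      - deriv (deriv (fun t : ℝ => moyalBasis θ k l (x₁, t))) x₂
      + (4 / (θ : ℂ) ^ 2) * (((x₁ : ℂ) ^ 2 + (x₂ : ℂ) ^ 2)) * moyalBasis θ k l (x₁, x₂)
      = (4 / (θ : ℂ)) * ((k : ℂ) + (l : ℂ) + 1) * moyalBasis θ k l (x₁, x₂) := by
  have haux (k l : ℕ) (x y : ℝ) :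
      (laguerreL k (l - k) ((2 * x ^ 2 + 2 * y ^ 2) / θ) : ℂ)
        = (laguerrePoly k (l - k)).eval (2 * (θ : ℂ)⁻¹ * ((x : ℂ) ^ 2 + (y : ℂ) ^ 2)) ∧
      ((Real.exp (-(x ^ 2 + y ^ 2) / θ) : ℝ) : ℂ)
        = Complex.exp (-((θ : ℂ)⁻¹ * ((x : ℂ) ^ 2 + (y : ℂ) ^ 2))) := by
    constructor
    · rw [← eval_laguerrePoly]
      congr 1
      push_cast
      ring
    · push_cast
      congr 1
      ring
  rcases le_or_gt k l with h | h
  · have key := laplacian_pow_mul_laguerre_mul_gaussian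
      (2 * (-1 : ℂ) ^ k * (Real.sqrt ((Nat.factorial k : ℝ) / (Nat.factorial l : ℝ)) : ℂ))
      Complex.I (θ : ℂ)⁻¹ Complex.I_sq k (l - k) (moyalBasis θ k l)
      (fun x y => by
        rw [moyalBasis, if_pos h, moyalBasisAux, (haux k l x y).1, (haux k l x y).2]
        simp only [Polynomial.eval_pow, Polynomial.eval_X]
        ring) x₁ x₂
    rw [Nat.cast_sub h] at key
    linear_combination key
  · have key := laplacian_pow_mul_laguerre_mul_gaussian
      (2 * (-1 : ℂ) ^ l * (Real.sqrt ((Nat.factorial l : ℝ) / (Nat.factorial k : ℝ)) : ℂ))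
      (-Complex.I) (θ : ℂ)⁻¹ (by simp) l (k - l) (moyalBasis θ k l)
      (fun x y => by
        rw [moyalBasis, if_neg (by omega), moyalBasisAux]
        simp only [map_mul, map_pow, map_add, Complex.conj_ofReal, Complex.conj_I, map_neg,
          map_one, map_ofNat]
        rw [(haux l k x y).1, (haux l k x y).2]
        simp only [Polynomial.eval_pow, Polynomial.eval_X]
        ring) x₁ x₂
    rw [Nat.cast_sub h.le] at key
    linear_combination key
end

section
/- Let μ² > 0 and let λ be a real number with λ > −μ²/2. Define R₂(z) := z + λ·Log(1 + z/μ²) on the half-plane H := {z ∈ ℂ : Re(z) > −μ²/2}, where Log denotes the principal branch of the complex logarithm. Then R₂ is holomorphic on H, injective on H, and its image R₂(H) contains the real half-line [0, ∞). -/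
/-- **Noshiro–Warschawski theorem**: a function on a convex set whose complex derivative has
positive real part is injective. -/
theorem Convex.injOn_of_hasDerivAt_re_pos {s : Set ℂ} (hs : Convex ℝ s) {f f' : ℂ → ℂ}
    (hf : ∀ z ∈ s, HasDerivAt f (f' z) z) (hpos : ∀ z ∈ s, 0 < (f' z).re) :
    Set.InjOn f s := by
  intro a ha b hb hab
  by_contra hne
  have hd : b - a ≠ 0 := sub_ne_zero.mpr (Ne.symm hne)
  have hmem : ∀ t ∈ Set.Icc (0 : ℝ) 1, a + (t : ℂ) * (b - a) ∈ s := fun t ht => by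
    simpa using hs.add_smul_sub_mem ha hb ht
  have hderiv : ∀ t ∈ Set.Icc (0 : ℝ) 1,
      HasDerivAt (fun t : ℝ => (f (a + (t : ℂ) * (b - a)) / (b - a)).re)
        (f' (a + (t : ℂ) * (b - a))).re t := by
    intro t ht
    have hline : HasDerivAt (fun w : ℂ => a + w * (b - a)) (b - a) (t : ℂ) := by
      simpa using ((hasDerivAt_id (t : ℂ)).mul_const (b - a)).const_add a
    have hcomp := ((hf _ (hmem t ht)).comp (t : ℂ) hline).div_const (b - a)
    rw [mul_div_cancel_right₀ _ hd] at hcomp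
    exact hcomp.real_of_complex
  obtain ⟨t, ht, h0⟩ := exists_hasDerivAt_eq_zero zero_lt_one
    (fun t ht => (hderiv t ht).continuousAt.continuousWithinAt)
    (by simp [hab]) (fun t ht => hderiv t (Set.Ioo_subset_Icc_self ht))
  exact (hpos _ (hmem t (Set.Ioo_subset_Icc_self ht))).ne' h0

theorem one_add_div_mem_slitPlane {m : ℝ} (hm : 0 < m) {z : ℂ} (hz : -m / 2 < z.re) :
    1 + z / (m : ℂ) ∈ Complex.slitPlane := by
  left
  have h : -1 < z.re / m := by rw [lt_div_iff₀ hm]; linarith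
  simpa [Complex.div_ofReal_re] using by linarith

theorem hasDerivAt_add_mul_log_one_add_div {m : ℝ} (hm : 0 < m) (c : ℂ) {z : ℂ}
    (hz : -m / 2 < z.re) :
    HasDerivAt (fun z : ℂ => z + c * Complex.log (1 + z / (m : ℂ))) (1 + c / (m + z)) z := by
  have hm0 : (m : ℂ) ≠ 0 := Complex.ofReal_ne_zero.mpr hm.ne'
  have hslit := one_add_div_mem_slitPlane hm hz
  have hlin : HasDerivAt (fun z : ℂ => 1 + z / (m : ℂ)) (1 / (m : ℂ)) z :=
    ((hasDerivAt_id z).div_const (m : ℂ)).const_add 1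
  have hsum : (m : ℂ) + z = m * (1 + z / m) := by field_simp
  have hval : 1 + c / (m + z) = 1 + c * (1 / (m : ℂ) / (1 + z / m)) := by
    rw [hsum, div_div, mul_one_div]
  rw [hval]
  exact (hasDerivAt_id z).add ((hlin.clog hslit).const_mul c)

theorem re_one_add_div_pos {m l : ℝ} (hm : 0 < m) (hl : -m / 2 < l) {z : ℂ}
    (hz : -m / 2 < z.re) : 0 < (1 + (l : ℂ) / (m + z)).re := by
  have hre : 0 < m + z.re := by linarith
  have hN : 0 < Complex.normSq (m + z) := by
    rw [Complex.normSq_pos]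
    intro h
    have := congrArg Complex.re h
    simp at this
    linarith
  have heq : (1 + (l : ℂ) / (m + z)).re
      = (Complex.normSq (m + z) + l * (m + z.re)) / Complex.normSq (m + z) := by
    simp [Complex.div_re]
    field_simp
  rw [heq]
  refine div_pos ?_ hN
  simp only [Complex.normSq_apply, Complex.add_re, Complex.add_im, Complex.ofReal_re,
    Complex.ofReal_im, zero_add]
  nlinarith [mul_pos hre (show 0 < m + z.re + l by linarith), mul_self_nonneg z.im]

theorem exists_nonneg_add_mul_log_one_add_div_eq {m l : ℝ} (hm : 0 < m) (hl : -m / 2 < l)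
    {x : ℝ} (hx : 0 ≤ x) : ∃ y : ℝ, 0 ≤ y ∧ y + l * Real.log (1 + y / m) = x := by
  have hcont : ContinuousOn (fun y : ℝ => y + l * Real.log (1 + y / m)) (Set.Icc 0 (2 * x)) := by
    refine continuousOn_id.add (continuousOn_const.mul (ContinuousOn.log (by fun_prop) ?_))
    intro y hy
    have := div_nonneg hy.1 hm.le
    positivity
  have hbound : x ≤ 2 * x + l * Real.log (1 + 2 * x / m) := by
    have hu : 0 ≤ 2 * x / m := by positivity
    have hlog0 : 0 ≤ Real.log (1 + 2 * x / m) := Real.log_nonneg (by linarith)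
    have hlog : Real.log (1 + 2 * x / m) ≤ 2 * x / m := by
      linarith [Real.log_le_sub_one_of_pos (show 0 < 1 + 2 * x / m by linarith)]
    have hcancel : m / 2 * (2 * x / m) = x := by field_simp
    nlinarith [mul_le_mul_of_nonneg_left hlog (half_pos hm).le,
      mul_nonneg (show 0 ≤ l + m / 2 by linarith) hlog0]
  obtain ⟨y, hy, hyx⟩ := intermediate_value_Icc (by linarith : (0 : ℝ) ≤ 2 * x) hcont
    (show x ∈ _ from ⟨by simpa using hx, hbound⟩)
  exact ⟨y, hy.1, hyx⟩

/-- For `μ² > 0` and real `λ > −μ²/2`, the function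
`R₂(z) = z + λ·Log(1 + z/μ²)` is holomorphic and injective on the half-plane
`H = {Re(z) > −μ²/2}`, and its image contains the real half-line `[0, ∞)`. -/
theorem stmt_8 (mu2 lam : ℝ) (hmu : 0 < mu2) (hlam : -mu2 / 2 < lam) :
    DifferentiableOn ℂ
        (fun z : ℂ => z + (lam : ℂ) * Complex.log (1 + z / (mu2 : ℂ)))
        {z : ℂ | -mu2 / 2 < z.re}
    ∧ Set.InjOn (fun z : ℂ => z + (lam : ℂ) * Complex.log (1 + z / (mu2 : ℂ)))
        {z : ℂ | -mu2 / 2 < z.re}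
    ∧ ∀ x : ℝ, 0 ≤ x →
        (x : ℂ) ∈ (fun z : ℂ => z + (lam : ℂ) * Complex.log (1 + z / (mu2 : ℂ))) ''
          {z : ℂ | -mu2 / 2 < z.re} := by
  have hderiv := fun (z : ℂ) (hz : z ∈ {z : ℂ | -mu2 / 2 < z.re}) =>
    hasDerivAt_add_mul_log_one_add_div hmu (lam : ℂ) hz
  refine ⟨fun z hz => (hderiv z hz).differentiableAt.differentiableWithinAt,
    (convex_halfSpace_re_gt _).injOn_of_hasDerivAt_re_pos hderiv
      fun z hz => re_one_add_div_pos hmu hlam hz, fun x hx => ?_⟩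
  obtain ⟨y, hy, hyx⟩ := exists_nonneg_add_mul_log_one_add_div_eq hmu hlam hx
  refine ⟨y, show -mu2 / 2 < y by linarith, ?_⟩
  have hpos : 0 ≤ 1 + y / mu2 := by positivity
  simp only [← hyx]
  push_cast [Complex.ofReal_log hpos]
  rfl
end

section
/- Let μ² > 0 and let z be a real number with z ≥ 0. Then there exists λ₀ > 0 such that for every real λ with |λ| < λ₀ the series w(λ) := z + Σ_{n=1}^∞ ((−λ)^n/n!)·(d^{n−1}/dz^{n−1})[(Log(1 + z/μ²))^n] (iterated derivatives in the variable z, evaluated at z) converges absolutely, w(λ) lies in the half-plane {Re > −μ²/2}, and R₂(w(λ)) = z, i.e. the series gives the inverse R₂^{-1}(z) of the function R₂(u) := u + λ·Log(1 + u/μ²). -/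
open Metric Set

open scoped Real NNReal

namespace Complex

/-- Termwise integration of the Taylor series of `-log (1 - F)` along a circle. -/
theorem hasSum_circleIntegral_neg_log_one_sub {F : ℂ → ℂ} {c : ℂ} {r q : ℝ} (hr : 0 < r)
    (hF : ContinuousOn F (sphere c r)) (hq : q < 1) (hFq : ∀ u ∈ sphere c r, ‖F u‖ ≤ q) :
    HasSum (fun n : ℕ => ∮ u in C(c, r), F u ^ (n + 1) / (n + 1))
      (∮ u in C(c, r), -log (1 - F u)) := by
  have hmem (θ : ℝ) : circleMap c r θ ∈ sphere c r := circleMap_mem_sphere c hr.le θ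
  have hcont : Continuous fun θ => F (circleMap c r θ) :=
    hF.comp_continuous (continuous_circleMap c r) hmem
  have hq0 : 0 ≤ q := (norm_nonneg _).trans (hFq _ (hmem 0))
  refine intervalIntegral.hasSum_integral_of_dominated_convergence
    (fun n _ => r * q ^ n) (fun n => ?_) (fun n => ?_) ?_ ?_ ?_
  · simp only [deriv_circleMap]
    exact (((continuous_circleMap 0 r).mul continuous_const).smul
      ((hcont.pow (n + 1)).div_const _)).aestronglyMeasurable
  · refine .of_forall fun θ _ => ?_
    have hn : ‖(n : ℂ) + 1‖ = n + 1 := by exact_mod_cast norm_natCast (n + 1)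
    have hpow : ‖F (circleMap c r θ)‖ ^ (n + 1) ≤ q ^ n :=
      (pow_le_pow_left₀ (norm_nonneg _) (hFq _ (hmem θ)) _).trans
        (pow_le_pow_of_le_one hq0 hq.le n.le_succ)
    simp only [deriv_circleMap, norm_smul, norm_mul, norm_circleMap_zero, norm_I, mul_one,
      norm_div, norm_pow, hn, abs_of_pos hr]
    gcongr
    exact (div_le_self (by positivity) (by linarith [n.cast_nonneg (α := ℝ)])).trans hpow
  · exact .of_forall fun _ _ => (summable_geometric_of_lt_one hq0 hq).mul_left r
  · exact intervalIntegrable_const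
  · exact .of_forall fun θ _ => HasSum.const_smul _
      (hasSum_taylorSeries_neg_log' ((hFq _ (hmem θ)).trans_lt hq))

theorem circleIntegral_neg_log_one_sub_div {a c : ℂ} {r : ℝ} (ha : ‖a‖ < r) :
    ∮ u in C(c, r), -log (1 - a / (u - c)) = 2 * π * I * a := by
  have hr : 0 < r := (norm_nonneg a).trans_lt ha
  have hne (u : ℂ) (hu : u ∈ sphere c r) : u - c ≠ 0 :=
    sub_ne_zero.2 (ne_of_mem_sphere hu hr.ne')
  have hsum := hasSum_circleIntegral_neg_log_one_sub (F := fun u => a / (u - c)) (c := c)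
    (q := ‖a‖ / r) hr (continuousOn_const.div (by fun_prop) hne) ((div_lt_one hr).2 ha)
    (fun u hu => by rw [norm_div, mem_sphere_iff_norm.1 hu])
  refine hsum.unique ?_
  have hterm (n : ℕ) : ∮ u in C(c, r), (a / (u - c)) ^ (n + 1) / (n + 1) =
      a ^ (n + 1) / (n + 1) * ∮ u in C(c, r), (u - c) ^ (-(n + 1 : ℤ)) := by
    rw [← circleIntegral.integral_const_mul]
    congr 1 with u
    rw [zpow_neg, div_pow]
    norm_cast
    ring
  have hzero : ∮ u in C(c, r), (a / (u - c)) ^ (0 + 1) / ((0 : ℕ) + 1) = 2 * π * I * a := by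
    rw [hterm]
    simp [circleIntegral.integral_sub_center_inv c hr.ne', mul_comm]
  rw [← hzero]
  refine hasSum_single 0 fun n hn => ?_
  rw [hterm, circleIntegral.integral_sub_zpow_of_ne (by omega), mul_zero]

theorem one_sub_mem_slitPlane {a : ℂ} (ha : ‖a‖ < 1) : 1 - a ∈ slitPlane := by
  simpa [sub_eq_add_neg] using mem_slitPlane_of_norm_lt_one (z := -a) (by simpa using ha)

theorem log_one_sub_mul_one_sub {a b : ℂ} (ha : ‖a‖ < 1) (hb : ‖b‖ < 1) :
    log ((1 - a) * (1 - b)) = log (1 - a) + log (1 - b) := by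
  have harg {x : ℂ} (hx : ‖x‖ < 1) : |arg (1 - x)| < π / 2 := by
    refine abs_arg_lt_pi_div_two_iff.2 (.inl ?_)
    rw [sub_re, one_re]
    linarith [re_le_norm x]
  obtain ⟨ha₁, ha₂⟩ := abs_lt.1 (harg ha)
  obtain ⟨hb₁, hb₂⟩ := abs_lt.1 (harg hb)
  exact log_mul (slitPlane_ne_zero (one_sub_mem_slitPlane ha))
    (slitPlane_ne_zero (one_sub_mem_slitPlane hb)) ⟨by linarith, by linarith⟩

theorem norm_dslope_le_of_lipschitzOnWith {f : ℂ → ℂ} {U : Set ℂ} {L : ℝ≥0} (hU : IsOpen U)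
    (hf : LipschitzOnWith L f U) {w u : ℂ} (hw : w ∈ U) (hu : u ∈ U) : ‖dslope f w u‖ ≤ L := by
  rcases eq_or_ne u w with rfl | hne
  · rw [dslope_same]
    exact norm_deriv_le_of_lipschitzOn (hU.mem_nhds hu) hf
  · rw [dslope_of_ne _ hne, slope_def_field, norm_div,
      div_le_iff₀ (norm_pos_iff.2 (sub_ne_zero.2 hne))]
    exact hf.norm_sub_le hu hw

/-- **Lagrange inversion**: a solution `w` of `w = z + t * f w` near `z` is the sum of the Lagrange
series of `f`. -/
theorem hasSum_lagrange_inversion {f : ℂ → ℂ} {U : Set ℂ} {z w t : ℂ} {r M : ℝ} {L : ℝ≥0}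
    (hU : IsOpen U) (hr : 0 < r) (hrU : closedBall z r ⊆ U) (hf : DifferentiableOn ℂ f U)
    (hL : LipschitzOnWith L f U) (hM : ∀ u ∈ closedBall z r, ‖f u‖ ≤ M)
    (htM : ‖t‖ * M < r) (htL : ‖t‖ * L < 1) (hw : w ∈ closedBall z r) (hwt : w = z + t * f w) :
    HasSum (fun n : ℕ => t ^ (n + 1) / ((n + 1).factorial : ℂ) *
      iteratedDeriv n (fun u => f u ^ (n + 1)) z) (w - z) := by
  have hsph : sphere z r ⊆ closedBall z r := sphere_subset_closedBall
  have hwz : ‖w - z‖ < r := by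
    rw [sub_eq_iff_eq_add'.2 hwt, norm_mul]
    exact (mul_le_mul_of_nonneg_left (hM w hw) (norm_nonneg t)).trans_lt htM
  have hne (u : ℂ) (hu : u ∈ sphere z r) : u - z ≠ 0 :=
    sub_ne_zero.2 (ne_of_mem_sphere hu hr.ne')
  have hslope (u : ℂ) (hu : u ∈ U) : ‖t * dslope f w u‖ < 1 := by
    rw [norm_mul]
    exact (mul_le_mul_of_nonneg_left (norm_dslope_le_of_lipschitzOnWith hU hL (hrU hw) hu)
      (norm_nonneg t)).trans_lt htL
  have hratio (u : ℂ) (hu : u ∈ sphere z r) : ‖(w - z) / (u - z)‖ < 1 := by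
    rw [norm_div, mem_sphere_iff_norm.1 hu]
    exact (div_lt_one hr).2 hwz
  have hdiff : DifferentiableOn ℂ (fun u => log (1 - t * dslope f w u)) U :=
    ((((differentiableOn_dslope (hU.mem_nhds (hrU hw))).2 hf).const_mul t).const_sub 1).clog
      fun u hu => one_sub_mem_slitPlane (hslope u hu)
  have hsum := hasSum_circleIntegral_neg_log_one_sub (F := fun u => t * f u / (u - z)) (c := z)
    (q := ‖t‖ * M / r) hr
    (((hf.continuousOn.mono (hsph.trans hrU)).const_mul t).div (by fun_prop) hne)
    ((div_lt_one hr).2 htM) (fun u hu => by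
      rw [norm_div, norm_mul, mem_sphere_iff_norm.1 hu]
      gcongr
      exact hM u (hsph hu))
  have hsplit : EqOn (fun u => -log (1 - t * f u / (u - z)))
      (fun u => -log (1 - (w - z) / (u - z)) - log (1 - t * dslope f w u)) (sphere z r) := by
    intro u hu
    have huw := sub_smul_dslope f w u
    rw [smul_eq_mul] at huw
    have hfac : 1 - t * f u / (u - z) =
        (1 - (w - z) / (u - z)) * (1 - t * dslope f w u) := by
      have := hne u hu
      field_simp
      linear_combination t * huw + hwt
    simp only [hfac, log_one_sub_mul_one_sub (hratio u hu) (hslope u (hrU (hsph hu)))]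
    ring
  have hint : ∮ u in C(z, r), -log (1 - t * f u / (u - z)) = 2 * π * I * (w - z) := by
    rw [circleIntegral.integral_congr hr.le hsplit, circleIntegral.integral_sub,
      circleIntegral_neg_log_one_sub_div hwz,
      (hdiff.diffContOnCl_ball hrU).circleIntegral_eq_zero hr.le, sub_zero]
    · refine ContinuousOn.circleIntegrable hr.le (ContinuousOn.neg (ContinuousOn.clog ?_ ?_))
      · exact continuousOn_const.sub (continuousOn_const.div (by fun_prop) hne)
      · exact fun u hu => one_sub_mem_slitPlane (hratio u hu)
    · exact (hdiff.continuousOn.mono (hsph.trans hrU)).circleIntegrable hr.le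
  have hterm (n : ℕ) : ∮ u in C(z, r), (t * f u / (u - z)) ^ (n + 1) / (n + 1) =
      2 * π * I * (t ^ (n + 1) / ((n + 1).factorial : ℂ) *
        iteratedDeriv n (fun u => f u ^ (n + 1)) z) := by
    have hcauchy := ((hf.mono hrU).pow (n + 1)).circleIntegral_one_div_sub_center_pow_smul hr n
    have hfun : (fun u => (t * f u / (u - z)) ^ (n + 1) / ((n : ℂ) + 1)) = fun u =>
        t ^ (n + 1) / (n + 1) * ((1 / (u - z) ^ (n + 1)) • (f ^ (n + 1)) u) := by
      ext u
      simp only [smul_eq_mul, Pi.pow_apply]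
      rw [div_pow, mul_pow]
      ring
    rw [hfun, circleIntegral.integral_const_mul, hcauchy, Nat.factorial_succ, smul_eq_mul]
    have hn : (n : ℂ) + 1 ≠ 0 := n.cast_add_one_ne_zero
    have hn' : (n.factorial : ℂ) ≠ 0 := mod_cast n.factorial_ne_zero
    push_cast
    simp only [Pi.pow_def]
    field_simp
  rw [hint] at hsum
  simp only [hterm] at hsum
  exact (hasSum_mul_left_iff two_pi_I_ne_zero).1 hsum

theorem exists_eq_add_mul_of_lipschitzOnWith {f : ℂ → ℂ} {z t : ℂ} {r M : ℝ} {L : ℝ≥0}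
    (hr : 0 ≤ r) (hL : LipschitzOnWith L f (closedBall z r))
    (hM : ∀ u ∈ closedBall z r, ‖f u‖ ≤ M) (htM : ‖t‖ * M ≤ r) (htL : ‖t‖ * L < 1) :
    ∃ w ∈ closedBall z r, w = z + t * f w := by
  have hmaps : MapsTo (fun u => z + t * f u) (closedBall z r) (closedBall z r) := by
    intro u hu
    rw [mem_closedBall_iff_norm, add_sub_cancel_left, norm_mul]
    exact (mul_le_mul_of_nonneg_left (hM u hu) (norm_nonneg t)).trans htM
  have hcontr : ContractingWith (‖t‖₊ * L) (hmaps.restrict _ _ _) := by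
    refine ⟨by exact_mod_cast htL, LipschitzWith.of_dist_le_mul fun x y => ?_⟩
    rw [Subtype.dist_eq, Subtype.dist_eq, MapsTo.val_restrict_apply, MapsTo.val_restrict_apply,
      dist_eq_norm, dist_eq_norm, add_sub_add_left_eq_sub, ← mul_sub, norm_mul, NNReal.coe_mul,
      coe_nnnorm, mul_assoc]
    exact mul_le_mul_of_nonneg_left (hL.norm_sub_le x.2 y.2) (norm_nonneg t)
  obtain ⟨w, hw, hfix, -⟩ := hcontr.exists_fixedPoint' isClosed_closedBall.isComplete hmaps
    (mem_closedBall_self hr) (edist_ne_top _ _)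
  exact ⟨w, hw, hfix.symm⟩

/-- Distance at least `m / 2` from the singularity of `u ↦ log (1 + u / m)`. -/
theorem half_lt_norm_add_ofReal {m : ℝ} {u : ℂ} (hu : -m / 2 < u.re) : m / 2 < ‖u + m‖ := by
  refine lt_of_lt_of_le ?_ (re_le_norm _)
  rw [add_re, ofReal_re]
  linarith

theorem hasDerivAt_log_one_add_div {m : ℝ} (hm : 0 < m) {u : ℂ} (hu : -m / 2 < u.re) :
    HasDerivAt (fun u : ℂ => log (1 + u / m)) (u + m)⁻¹ u := by
  have hm' : (m : ℂ) ≠ 0 := mod_cast hm.ne'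
  have hslit : 1 + u / m ∈ slitPlane := by
    refine .inl ?_
    rw [add_re, one_re, div_ofReal_re]
    have : -(1 / 2) < u.re / m := by rw [lt_div_iff₀ hm]; linarith
    linarith
  convert (((hasDerivAt_id' u).div_const (m : ℂ)).const_add 1).clog hslit using 1
  rw [one_add_div hm', div_div_div_cancel_right₀ hm', one_div, add_comm]

theorem lipschitzOnWith_log_one_add_div {m : ℝ≥0} (hm : 0 < m) :
    LipschitzOnWith (2 / m) (fun u : ℂ => log (1 + u / (m : ℝ))) {u | -(m : ℝ) / 2 < u.re} := by
  refine (convex_halfSpace_re_gt _).lipschitzOnWith_of_nnnorm_hasDerivWithin_le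
    (fun u hu => (hasDerivAt_log_one_add_div hm hu).hasDerivWithinAt) (fun u hu => ?_)
  rw [← NNReal.coe_le_coe, coe_nnnorm, norm_inv, NNReal.coe_div, NNReal.coe_two, ← inv_div]
  exact inv_anti₀ (half_pos hm) (half_lt_norm_add_ofReal hu).le

end Complex

/-- For `μ² > 0` and real `z ≥ 0` there is `λ₀ > 0` such that for all real
`λ` with `|λ| < λ₀` the Lagrange inversion series
`w(λ) = z + ∑_{n≥1} ((−λ)ⁿ/n!)·(d^{n−1}/dz^{n−1})(Log(1+z/μ²))ⁿ` converges absolutely,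
`w(λ)` lies in the half-plane `{Re > −μ²/2}`, and `R₂(w(λ)) = z`, i.e.
`w(λ) + λ·Log(1 + w(λ)/μ²) = z`. -/
theorem stmt_9 (mu2 : ℝ) (hmu : 0 < mu2) (z : ℝ) (hz : 0 ≤ z) :
    ∃ lam0 : ℝ, 0 < lam0 ∧ ∀ lam : ℝ, |lam| < lam0 →
      Summable (fun n : ℕ =>
        ‖((-(lam : ℂ)) ^ (n + 1) / ((n + 1).factorial : ℂ)) *
          iteratedDeriv n
            (fun u : ℂ => (Complex.log (1 + u / (mu2 : ℂ))) ^ (n + 1)) (z : ℂ)‖)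
      ∧ ∃ w : ℂ,
          w = (z : ℂ) + ∑' n : ℕ,
              ((-(lam : ℂ)) ^ (n + 1) / ((n + 1).factorial : ℂ)) *
                iteratedDeriv n
                  (fun u : ℂ => (Complex.log (1 + u / (mu2 : ℂ))) ^ (n + 1)) (z : ℂ)
          ∧ -mu2 / 2 < w.re
          ∧ w + (lam : ℂ) * Complex.log (1 + w / (mu2 : ℂ)) = (z : ℂ) := by
  lift mu2 to ℝ≥0 using hmu.le
  set f : ℂ → ℂ := fun u => Complex.log (1 + u / ((mu2 : ℝ) : ℂ))
  set U : Set ℂ := {u | -(mu2 : ℝ) / 2 < u.re}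
  set r : ℝ := mu2 / 4
  have hr : 0 < r := by positivity
  have hrU : closedBall (z : ℂ) r ⊆ U := by
    intro u hu
    have hre := (Complex.abs_re_le_norm _).trans (mem_closedBall_iff_norm.1 hu)
    rw [Complex.sub_re, Complex.ofReal_re] at hre
    have hlow := (abs_le.1 hre).1
    simp only [U, mem_ofPred_eq, r] at hlow ⊢
    linarith
  have hU : IsOpen U := isOpen_lt continuous_const Complex.continuous_re
  have hf : DifferentiableOn ℂ f U := fun u hu =>
    (Complex.hasDerivAt_log_one_add_div hmu hu).differentiableAt.differentiableWithinAt
  have hL : LipschitzOnWith (2 / mu2) f U := Complex.lipschitzOnWith_log_one_add_div hmu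
  obtain ⟨M, hM⟩ := (isCompact_closedBall (z : ℂ) r).exists_bound_of_continuousOn
    (hf.continuousOn.mono hrU)
  have hM0 : 0 ≤ M := (norm_nonneg _).trans (hM z (mem_closedBall_self hr.le))
  refine ⟨min (r / (M + 1)) (mu2 / 2), by positivity, fun lam hlam => ?_⟩
  obtain ⟨hlam₁, hlam₂⟩ := lt_min_iff.1 hlam
  have hnorm : ‖-(lam : ℂ)‖ = |lam| := by simp
  have htM : ‖-(lam : ℂ)‖ * M < r := by
    rw [lt_div_iff₀ (by positivity)] at hlam₁
    rw [hnorm]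
    linarith [abs_nonneg lam]
  have htL : ‖-(lam : ℂ)‖ * (2 / mu2 : ℝ≥0) < 1 := by
    rw [hnorm, NNReal.coe_div, NNReal.coe_two, ← mul_div_assoc, div_lt_one hmu]
    linarith
  obtain ⟨w, hw, hwt⟩ :=
    Complex.exists_eq_add_mul_of_lipschitzOnWith hr.le (hL.mono hrU) hM htM.le htL
  have hsum := Complex.hasSum_lagrange_inversion hU hr hrU hf hL hM htM htL hw hwt
  refine ⟨hsum.summable.norm, w, ?_, hrU hw, ?_⟩
  · rw [hsum.tsum_eq, add_sub_cancel]
  · linear_combination hwt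
end

section
/- Let m ≥ 1 be an integer and let a ∈ ℂ with a ∉ (−∞, −1]. Then the function t ↦ t^{m−1}·[ 1/(1+a+t) − Σ_{j=0}^{m−1} (−a)^j/(1+t)^{j+1} ] is absolutely integrable on (0,∞), the function t ↦ t^{m−1}/((1+a+t)·(1+t)^m) is absolutely integrable on (0,∞), and ∫₀^∞ t^{m−1}·[ 1/(1+a+t) − Σ_{j=0}^{m−1} (−a)^j/(1+t)^{j+1} ] dt = (−a)^m·∫₀^∞ t^{m−1}·dt/((1+a+t)·(1+t)^m). In particular, for m = 1 both sides equal −Log(1+a), where Log is the principal branch of the complex logarithm. -/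
open MeasureTheory Finset

/-- For `a ∉ (−∞,−1]` the propagator denominator does not vanish on `[0,∞)`. -/
lemma one_add_add_ofReal_ne_zero {a : ℂ} (ha : ∀ x : ℝ, x ≤ -1 → a ≠ (x : ℂ)) {t : ℝ}
    (ht : 0 ≤ t) : 1 + a + (t : ℂ) ≠ 0 := by
  intro h
  refine ha (-1 - t) (by linarith) ?_
  push_cast
  linear_combination h

lemma one_add_ofReal_ne_zero {t : ℝ} (ht : 0 ≤ t) : 1 + (t : ℂ) ≠ 0 := by
  exact_mod_cast (by positivity : 1 + t ≠ 0)

lemma one_add_div_mem_slitPlane_s14 {a : ℂ} (ha : ∀ x : ℝ, x ≤ -1 → a ≠ (x : ℂ)) {t : ℝ}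
    (ht : 0 ≤ t) : 1 + a / (1 + (t : ℂ)) ∈ Complex.slitPlane := by
  rw [Complex.mem_slitPlane_iff_not_le_zero]
  intro h
  obtain ⟨hre, him⟩ := Complex.le_def.1 h
  set z : ℂ := 1 + a / (1 + (t : ℂ)) with hz
  have hzre : z = (z.re : ℂ) := Complex.ext (by simp) (by simpa using him)
  have haz : a = (z - 1) * (1 + (t : ℂ)) := by
    rw [hz, add_sub_cancel_left, div_mul_cancel₀ _ (one_add_ofReal_ne_zero ht)]
  refine ha ((z.re - 1) * (1 + t)) ?_ ?_
  · have : z.re ≤ 0 := by simpa using hre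
    nlinarith
  · push_cast
    rw [← hzre, ← haz]

/-- The remainder of the geometric expansion of `1/(z+a)` in powers of `a`. -/
lemma one_div_add_sub_sum {K : Type*} [Field K] {z a : K} (hz : z ≠ 0) (hza : z + a ≠ 0) (m : ℕ) :
    1 / (z + a) - ∑ j ∈ Finset.range m, (-a) ^ j / z ^ (j + 1)
      = (-a) ^ m / ((z + a) * z ^ m) := by
  induction m with
  | zero => simp
  | succ m ih =>
    rw [Finset.sum_range_succ, ← sub_sub, ih]
    field_simp
    ring

lemma integrableOn_pow_div_mul_pow {a : ℂ} (ha : ∀ x : ℝ, x ≤ -1 → a ≠ (x : ℂ)) (n : ℕ) :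
    IntegrableOn
      (fun t : ℝ => (t : ℂ) ^ n / ((1 + a + (t : ℂ)) * (1 + (t : ℂ)) ^ (n + 1)))
      (Set.Ioi 0) := by
  have hcont : ContinuousOn
      (fun t : ℝ => (t : ℂ) ^ n / ((1 + a + (t : ℂ)) * (1 + (t : ℂ)) ^ (n + 1)))
      (Set.Ici 0) := by
    refine ContinuousOn.div (by fun_prop) (by fun_prop) fun t ht => ?_
    exact mul_ne_zero (one_add_add_ofReal_ne_zero ha ht)
      (pow_ne_zero _ (one_add_ofReal_ne_zero ht))
  refine ((hcont.locallyIntegrableOn measurableSet_Ici).integrableOn_of_isBigO_atTop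
    (g := fun t : ℝ => t ^ (-2 : ℝ)) ?_ ?_).mono_set Set.Ioi_subset_Ici_self
  · refine Asymptotics.IsBigO.of_bound 2 ?_
    filter_upwards [Filter.eventually_ge_atTop (2 * ‖a‖), Filter.eventually_gt_atTop 0]
      with t hta ht
    have hfar : t / 2 ≤ ‖1 + a + (t : ℂ)‖ := by
      have h := norm_sub_le (1 + a + (t : ℂ)) a
      have h1 : ‖1 + a + (t : ℂ) - a‖ = 1 + t := by
        rw [show 1 + a + (t : ℂ) - a = ((1 + t : ℝ) : ℂ) by push_cast; ring,
          Complex.norm_of_nonneg (by positivity)]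
      linarith
    have hnear : t ≤ ‖1 + (t : ℂ)‖ := by
      rw [show 1 + (t : ℂ) = ((1 + t : ℝ) : ℂ) by push_cast; ring,
        Complex.norm_of_nonneg (by positivity)]
      linarith
    rw [norm_div, norm_mul, norm_pow, norm_pow, Complex.norm_of_nonneg ht.le,
      Real.norm_of_nonneg (by positivity), Real.rpow_neg ht.le, Real.rpow_two]
    calc t ^ n / (‖1 + a + (t : ℂ)‖ * ‖1 + (t : ℂ)‖ ^ (n + 1))
        ≤ t ^ n / (t / 2 * t ^ (n + 1)) := by gcongr
      _ = 2 * (t ^ 2)⁻¹ := by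
        field_simp
        ring
  · exact ⟨Set.Ioi 1, Filter.Ioi_mem_atTop 1,
      integrableOn_Ioi_rpow_of_lt (by norm_num) one_pos⟩

lemma integral_neg_div_mul_eq_neg_log {a : ℂ} (ha : ∀ x : ℝ, x ≤ -1 → a ≠ (x : ℂ)) :
    ∫ t in Set.Ioi (0 : ℝ), -a * (1 / ((1 + a + (t : ℂ)) * (1 + (t : ℂ))))
      = -Complex.log (1 + a) := by
  have hderiv : ∀ t ∈ Set.Ici (0 : ℝ),
      HasDerivAt (fun t : ℝ => Complex.log (1 + a / (1 + (t : ℂ))))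
        (-a * (1 / ((1 + a + (t : ℂ)) * (1 + (t : ℂ))))) t := by
    intro t ht
    have h1 := one_add_ofReal_ne_zero ht
    have h2 := one_add_add_ofReal_ne_zero ha ht
    have hden : HasDerivAt (fun t : ℝ => 1 + (t : ℂ)) 1 t :=
      (Complex.ofRealCLM.hasDerivAt (x := t)).const_add 1
    have hslit := one_add_div_mem_slitPlane_s14 ha ht
    convert! (((hasDerivAt_const t a).fun_div hden h1).const_add 1).clog_real hslit using 1
    have h4 : 1 + a / (1 + (t : ℂ)) = (1 + a + t) / (1 + t) := by
      field_simp
      ring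
    rw [h4]
    field_simp
    ring
  have hlim : Filter.Tendsto (fun t : ℝ => Complex.log (1 + a / (1 + (t : ℂ))))
      Filter.atTop (nhds 0) := by
    have hinv : Filter.Tendsto (fun t : ℝ => (((1 + t)⁻¹ : ℝ) : ℂ)) Filter.atTop
        (nhds ((0 : ℝ) : ℂ)) :=
      (Complex.continuous_ofReal.tendsto 0).comp
        (Filter.tendsto_atTop_add_const_left _ 1 Filter.tendsto_id).inv_tendsto_atTop
    have harg : Filter.Tendsto (fun t : ℝ => 1 + a / (1 + (t : ℂ))) Filter.atTop (nhds 1) := by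
      simpa [div_eq_mul_inv] using (hinv.const_mul a).const_add 1
    simpa using harg.clog Complex.one_mem_slitPlane
  have hint : IntegrableOn (fun t : ℝ => -a * (1 / ((1 + a + (t : ℂ)) * (1 + (t : ℂ)))))
      (Set.Ioi 0) := by
    simpa [IntegrableOn] using (integrableOn_pow_div_mul_pow ha 0).const_mul (-a)
  simpa using integral_Ioi_of_hasDerivAt_of_tendsto' hderiv hint hlim

/-- For an integer `m ≥ 1` and `a ∈ ℂ ∖ (−∞,−1]`, the Taylor-subtracted
tadpole integrand `t^{m−1}·[1/(1+a+t) − ∑_{j=0}^{m−1} (−a)^j/(1+t)^{j+1}]` is absolutely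
integrable on `(0,∞)`, as is `t^{m−1}/((1+a+t)(1+t)^m)`, and
`∫₀^∞ t^{m−1}·[1/(1+a+t) − ∑_j (−a)^j/(1+t)^{j+1}] dt
  = (−a)^m·∫₀^∞ t^{m−1} dt/((1+a+t)(1+t)^m)`;
for `m = 1` both sides equal `−Log(1+a)`. -/
theorem stmt_14 (m : ℕ) (hm : 1 ≤ m) (a : ℂ) (ha : ∀ x : ℝ, x ≤ -1 → a ≠ (x : ℂ)) :
    IntegrableOn
      (fun t : ℝ => (t : ℂ) ^ (m - 1) *
        (1 / (1 + a + (t : ℂ))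
          - ∑ j ∈ Finset.range m, (-a) ^ j / (1 + (t : ℂ)) ^ (j + 1)))
      (Set.Ioi 0)
    ∧ IntegrableOn
        (fun t : ℝ => (t : ℂ) ^ (m - 1) / ((1 + a + (t : ℂ)) * (1 + (t : ℂ)) ^ m))
        (Set.Ioi 0)
    ∧ (∫ t in Set.Ioi (0 : ℝ), (t : ℂ) ^ (m - 1) *
          (1 / (1 + a + (t : ℂ))
            - ∑ j ∈ Finset.range m, (-a) ^ j / (1 + (t : ℂ)) ^ (j + 1)))
        = (-a) ^ m *
            ∫ t in Set.Ioi (0 : ℝ),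
              (t : ℂ) ^ (m - 1) / ((1 + a + (t : ℂ)) * (1 + (t : ℂ)) ^ m)
    ∧ (m = 1 →
        (∫ t in Set.Ioi (0 : ℝ), (t : ℂ) ^ (m - 1) *
            (1 / (1 + a + (t : ℂ))
              - ∑ j ∈ Finset.range m, (-a) ^ j / (1 + (t : ℂ)) ^ (j + 1)))
          = -Complex.log (1 + a)
        ∧ (-a) ^ m *
            (∫ t in Set.Ioi (0 : ℝ),
              (t : ℂ) ^ (m - 1) / ((1 + a + (t : ℂ)) * (1 + (t : ℂ)) ^ m))
          = -Complex.log (1 + a)) := by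
  obtain ⟨n, rfl⟩ : ∃ n, m = n + 1 := ⟨m - 1, by omega⟩
  rw [Nat.add_sub_cancel]
  have hint := integrableOn_pow_div_mul_pow ha n
  have hcongr : Set.EqOn
      (fun t : ℝ => (-a) ^ (n + 1) *
        ((t : ℂ) ^ n / ((1 + a + (t : ℂ)) * (1 + (t : ℂ)) ^ (n + 1))))
      (fun t : ℝ => (t : ℂ) ^ n *
        (1 / (1 + a + (t : ℂ))
          - ∑ j ∈ Finset.range (n + 1), (-a) ^ j / (1 + (t : ℂ)) ^ (j + 1)))
      (Set.Ioi 0) := by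
    intro t ht
    have hne := one_add_add_ofReal_ne_zero ha (le_of_lt ht)
    have hcomm : 1 + a + (t : ℂ) = 1 + t + a := by ring
    rw [hcomm] at hne
    simp only [hcomm, one_div_add_sub_sum (one_add_ofReal_ne_zero (le_of_lt ht)) hne]
    ring
  have heq := setIntegral_congr_fun (μ := volume) measurableSet_Ioi hcongr
  rw [integral_const_mul] at heq
  refine ⟨IntegrableOn.congr_fun (hint.const_mul _) hcongr measurableSet_Ioi, hint, heq.symm,
    fun h => ?_⟩
  rw [← heq, and_self]
  obtain rfl : n = 0 := by omega
  rw [← integral_const_mul, ← integral_neg_div_mul_eq_neg_log ha]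
  simp
end
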